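/- For every α ∈ [0,1] and every compact set Y ⊆ ℝ containing a non-zero point, there exists a compact set R ⊆ (0,∞) with dim_H(R) = dim_F(R) = α and dim_F(RY) ≥ min{1, dim_F(R) + dim_F(Y)}, where RY = {ry : r ∈ R, y ∈ Y}. -/

import Mathlib

open MeasureTheory
open scoped ENNReal

/-- Fourier transform of a measure on `ℝ`. -/
noncomputable def ft1 (μ : Measure ℝ) (ξ : ℝ) : ℂ :=
  ∫ x, Complex.exp (((-2 * Real.pi * x * ξ : ℝ) : ℂ) * Complex.I) ∂μ

/-- Fourier dimension of a set `A ⊆ ℝ`. -/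
noncomputable def fDimS1 (A : Set ℝ) : ℝ :=
  sSup {s : ℝ | 0 ≤ s ∧ s ≤ 1 ∧ ∃ μ : Measure ℝ,
    μ ≠ 0 ∧ IsFiniteMeasure μ ∧ (∃ K, IsCompact K ∧ K ⊆ A ∧ μ Kᶜ = 0) ∧
    ∃ C : ℝ, ∀ ξ, ‖ft1 μ ξ‖ ^ 2 * |ξ| ^ s ≤ C}

/-- Greedy choice of signs keeping a sum of hyperbolic cosines small. -/
theorem exists_signs_sum_cosh_le {ι : Type*} (J : Finset ι) (a : ι → ℕ → ℝ) (c : ℝ)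
    (ha : ∀ j ∈ J, ∀ i, |a j i| ≤ c) (N : ℕ) :
    ∃ s : ℕ → ℝ, (∀ i, s i = 1 ∨ s i = -1) ∧
      ∑ j ∈ J, Real.cosh (∑ i ∈ Finset.range N, s i * a j i)
        ≤ J.card * Real.exp (N * (c ^ 2 / 2)) := by
  induction N with
  | zero => exact ⟨fun _ => 1, fun _ => Or.inl rfl, by simp⟩
  | succ N ih =>
    obtain ⟨s, hs, hle⟩ := ih
    set T : ι → ℝ := fun j => ∑ i ∈ Finset.range N, s i * a j i with hT
    have hcosh : ∀ j ∈ J, Real.cosh (a j N) ≤ Real.exp (c ^ 2 / 2) := fun j hj => by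
      refine (Real.cosh_le_exp_half_sq _).trans (Real.exp_le_exp.2 ?_)
      have := sq_le_sq' (neg_le_of_abs_le (ha j hj N)) (le_of_abs_le (ha j hj N))
      linarith
    have havg : ∑ j ∈ J, Real.cosh (T j + a j N) + ∑ j ∈ J, Real.cosh (T j + -a j N)
        ≤ 2 * (J.card * Real.exp ((N + 1 : ℕ) * (c ^ 2 / 2))) := by
      rw [← Finset.sum_add_distrib]
      calc ∑ j ∈ J, (Real.cosh (T j + a j N) + Real.cosh (T j + -a j N))
          ≤ ∑ j ∈ J, 2 * (Real.cosh (T j) * Real.exp (c ^ 2 / 2)) := by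
            refine Finset.sum_le_sum fun j hj => ?_
            have h1 := mul_le_mul_of_nonneg_left (hcosh j hj) (Real.cosh_pos (T j)).le
            rw [Real.cosh_add, Real.cosh_add, Real.cosh_neg, Real.sinh_neg]
            linarith
        _ = 2 * ((∑ j ∈ J, Real.cosh (T j)) * Real.exp (c ^ 2 / 2)) := by
            rw [← Finset.mul_sum, Finset.sum_mul]
        _ ≤ 2 * ((J.card * Real.exp (N * (c ^ 2 / 2))) * Real.exp (c ^ 2 / 2)) := by
            gcongr
        _ = _ := by
            rw [mul_assoc (J.card : ℝ), ← Real.exp_add]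
            push_cast
            ring_nf
    have hupd : ∀ e : ℝ, ∀ j, ∑ i ∈ Finset.range (N + 1), Function.update s N e i * a j i
        = T j + e * a j N := fun e j => by
      rw [Finset.sum_range_succ, Function.update_self]
      congr 1
      refine Finset.sum_congr rfl fun i hi => ?_
      rw [Function.update_of_ne (Finset.mem_range.1 hi).ne]
    have hpm : ∀ e : ℝ, (e = 1 ∨ e = -1) → ∀ i,
        Function.update s N e i = 1 ∨ Function.update s N e i = -1 := fun e he i => by
      rcases eq_or_ne i N with rfl | h
      · simpa using he
      · simpa [Function.update_of_ne h] using hs i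
    rcases le_total (∑ j ∈ J, Real.cosh (T j + a j N))
      (∑ j ∈ J, Real.cosh (T j + -a j N)) with h | h
    · refine ⟨Function.update s N 1, hpm 1 (Or.inl rfl), ?_⟩
      simp only [hupd, one_mul]
      linarith
    · refine ⟨Function.update s N (-1), hpm (-1) (Or.inr rfl), ?_⟩
      simp only [hupd, neg_one_mul]
      linarith

theorem exists_signs_abs_sum_le {ι : Type*} (J : Finset ι) (a : ι → ℕ → ℝ) (b : ι → ℝ)
    (ha : ∀ j ∈ J, ∀ i, |a j i| ≤ b j) (N : ℕ) (hN : 0 < N) :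
    ∃ s : ℕ → ℝ, (∀ i, s i = 1 ∨ s i = -1) ∧ ∀ j ∈ J,
      |∑ i ∈ Finset.range N, s i * a j i| ≤ b j * (√N * (Real.log (2 * J.card) + 1 / 2)) := by
  have hN' : (0 : ℝ) < √N := Real.sqrt_pos.2 (by exact_mod_cast hN)
  obtain ⟨s, hs, h⟩ := exists_signs_sum_cosh_le J (fun j i => a j i / b j / √N) (1 / √N)
    (fun j hj i => by
      rw [abs_div, abs_of_pos hN']
      gcongr
      rw [abs_div]
      exact div_le_one_of_le₀ ((ha j hj i).trans (le_abs_self _)) (abs_nonneg _)) N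
  refine ⟨s, hs, fun j hj => ?_⟩
  have hb : 0 ≤ b j := (abs_nonneg _).trans (ha j hj 0)
  rcases hb.eq_or_lt with hb0 | hb0
  · have : ∀ i, a j i = 0 := fun i => by
      have := ha j hj i
      rw [← hb0] at this
      exact abs_nonpos_iff.1 this
    simp [this, ← hb0]
  have hcard : (0 : ℝ) < J.card := by exact_mod_cast Finset.card_pos.2 ⟨j, hj⟩
  set S := ∑ i ∈ Finset.range N, s i * a j i with hS
  have hsum : ∑ i ∈ Finset.range N, s i * (a j i / b j / √N) = S / b j / √N := by
    rw [hS, Finset.sum_div, Finset.sum_div]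
    exact Finset.sum_congr rfl fun i _ => by ring
  have h1 : Real.cosh (S / b j / √N) ≤ J.card * Real.exp (1 / 2) := by
    rw [← hsum]
    have h2 := Finset.single_le_sum (f := fun j => Real.cosh
      (∑ i ∈ Finset.range N, s i * (a j i / b j / √N))) (fun j _ => (Real.cosh_pos _).le) hj
    refine h2.trans (h.trans_eq ?_)
    congr 2
    rw [div_pow, Real.sq_sqrt (by positivity)]
    field_simp
  have h3 : Real.exp |S / b j / √N| ≤ 2 * J.card * Real.exp (1 / 2) := by
    have := Real.cosh_eq |S / b j / √N|
    rw [Real.cosh_abs] at this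
    have := Real.exp_pos (-|S / b j / √N|)
    linarith
  have h4 : |S / b j / √N| ≤ Real.log (2 * J.card) + 1 / 2 := by
    rw [← Real.log_exp (1 / 2), ← Real.log_mul (by positivity) (by positivity)]
    exact (Real.le_log_iff_exp_le (by positivity)).2 h3
  rw [abs_div, abs_div, abs_of_pos hb0, abs_of_pos hN', div_div, div_le_iff₀ (by positivity)] at h4
  linarith

theorem exists_signs_norm_sum_le {ι : Type*} (J : Finset ι) (a : ι → ℕ → ℂ) (b : ι → ℝ)
    (ha : ∀ j ∈ J, ∀ i, ‖a j i‖ ≤ b j) (N : ℕ) (hN : 0 < N) :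
    ∃ s : ℕ → ℝ, (∀ i, s i = 1 ∨ s i = -1) ∧ ∀ j ∈ J,
      ‖∑ i ∈ Finset.range N, (s i : ℂ) * a j i‖
        ≤ 2 * (b j * (√N * (Real.log (4 * J.card) + 1 / 2))) := by
  obtain ⟨s, hs, h⟩ := exists_signs_abs_sum_le (J ×ˢ (Finset.univ : Finset Bool))
    (fun p i => if p.2 then (a p.1 i).re else (a p.1 i).im) (fun p => b p.1)
    (fun p hp i => by
      have hp1 := (Finset.mem_product.1 hp).1
      split_ifs
      · exact (Complex.abs_re_le_norm _).trans (ha _ hp1 i)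
      · exact (Complex.abs_im_le_norm _).trans (ha _ hp1 i)) N hN
  refine ⟨s, hs, fun j hj => ?_⟩
  have hr := h (j, true) (by simp [hj])
  have hi := h (j, false) (by simp [hj])
  have hc : (2 : ℝ) * ((J ×ˢ (Finset.univ : Finset Bool)).card : ℝ) = 4 * J.card := by
    simp [Finset.card_product]
    ring
  rw [hc] at hr hi
  simp only [if_true, Bool.false_eq_true, if_false] at hr hi
  refine (Complex.norm_le_abs_re_add_abs_im _).trans ?_
  simp only [Complex.re_sum, Complex.im_sum, Complex.re_ofReal_mul, Complex.im_ofReal_mul]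
  linarith

theorem volume_floor_fiber_le {Q : ℝ} (hQ : 0 < Q) (i : ℕ) :
    volume.real (Set.Ico (0 : ℝ) 1 ∩ {t | ⌊Q * t⌋₊ = i}) ≤ 1 / Q := by
  have hsub : Set.Ico (0 : ℝ) 1 ∩ {t | ⌊Q * t⌋₊ = i} ⊆ Set.Icc (i / Q) ((i + 1) / Q) := by
    rintro t ⟨⟨ht0, -⟩, ht⟩
    have h := (Nat.floor_eq_iff (by positivity)).1 ht
    constructor
    · rw [div_le_iff₀ hQ]; linarith [h.1]
    · rw [le_div_iff₀ hQ]; linarith [h.2]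
  refine (measureReal_mono hsub (by simp)).trans ?_
  rw [Real.volume_real_Icc_of_le (by gcongr; linarith)]
  apply le_of_eq
  ring

/-- One step of the random digit construction: binary digits `s`, constant on the cells
`⌊Q t⌋ = i`, can be chosen so that finitely many integrals stay close to their averages. -/
theorem exists_digit_step {ι : Type*} (J : Finset ι) (G : ι → ℝ → ℂ) (B : ι → ℝ)
    (hG : ∀ j, Measurable (G j)) (hB : ∀ j, ∀ x, 1 ≤ x → ‖G j x‖ ≤ B j)
    {Q : ℝ} (hQ : 1 ≤ Q) {δ : ℝ} (hδ : 0 ≤ δ) (x : ℝ → ℝ) (hx : Measurable x)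
    (hx1 : ∀ t, 1 ≤ x t) :
    ∃ s : ℕ → ℝ, (∀ i, s i = 0 ∨ s i = 1) ∧ ∀ j ∈ J,
      ‖(∫ t in Set.Ico (0 : ℝ) 1, G j (x t + δ * s ⌊Q * t⌋₊))
        - ∫ t in Set.Ico (0 : ℝ) 1, (1 / 2 : ℂ) * (G j (x t) + G j (x t + δ))‖
        ≤ 4 * (Real.log (4 * J.card) + 1 / 2) * (B j / √Q) := by
  have hQ0 : 0 < Q := by linarith
  set w : ι → ℝ → ℂ := fun j t => (1 / 2 : ℂ) * (G j (x t + δ) - G j (x t)) with hw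
  have hwm : ∀ j, Measurable (w j) := fun j =>
    (((hG j).comp (hx.add_const δ)).sub ((hG j).comp hx)).const_mul _
  have hwB : ∀ j t, ‖w j t‖ ≤ B j := fun j t => by
    have h1 := hB j (x t) (hx1 t)
    have h2 := hB j (x t + δ) (by linarith [hx1 t])
    rw [hw, norm_mul]
    have h3 := norm_sub_le (G j (x t + δ)) (G j (x t))
    norm_num
    linarith
  have hB0 : ∀ j, 0 ≤ B j := fun j => (norm_nonneg _).trans (hwB j 0)
  set A : ℕ → Set ℝ := fun i => {t | ⌊Q * t⌋₊ = i} with hA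
  have hAm : ∀ i, MeasurableSet (A i) := fun i =>
    (Nat.measurable_floor.comp (measurable_const_mul Q)) (measurableSet_singleton i)
  have hwi : ∀ j, IntegrableOn (w j) (Set.Ico (0 : ℝ) 1) := fun j =>
    Measure.integrableOn_of_bounded (M := B j) (by simp) (hwm j).aestronglyMeasurable
      (ae_of_all _ (hwB j))
  obtain ⟨σ, hσ, hle⟩ := exists_signs_norm_sum_le J
    (fun j i => ∫ t in Set.Ico (0 : ℝ) 1 ∩ A i, w j t) (fun j => B j / Q)
    (fun j _ i => by
      refine (norm_setIntegral_le_of_norm_le_const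
        (measure_lt_top_of_subset Set.inter_subset_left (by simp)) fun t _ => hwB j t).trans ?_
      rw [div_eq_mul_one_div]
      exact mul_le_mul_of_nonneg_left (volume_floor_fiber_le hQ0 i) (hB0 j))
    (⌊Q⌋₊ + 1) (Nat.succ_pos _)
  refine ⟨fun i => (1 + σ i) / 2, fun i => ?_, fun j hj => ?_⟩
  · rcases hσ i with h | h <;> simp [h]
  have hpt : ∀ t, G j (x t + δ * ((1 + σ ⌊Q * t⌋₊) / 2))
      = (1 / 2 : ℂ) * (G j (x t) + G j (x t + δ)) + σ ⌊Q * t⌋₊ * w j t := fun t => by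
    rcases hσ ⌊Q * t⌋₊ with h | h <;> simp only [h, hw]
    · norm_num
      ring
    · norm_num
      ring
  have hsum : ∀ t ∈ Set.Ico (0 : ℝ) 1, (σ ⌊Q * t⌋₊ : ℂ) * w j t
      = ∑ i ∈ Finset.range (⌊Q⌋₊ + 1), (A i).indicator (fun t => (σ i : ℂ) * w j t) t := by
    intro t ht
    have hmem : ⌊Q * t⌋₊ ∈ Finset.range (⌊Q⌋₊ + 1) := by
      rw [Finset.mem_range, Nat.lt_succ_iff]
      exact Nat.floor_le_floor (by nlinarith [ht.1, ht.2])
    rw [Finset.sum_eq_single_of_mem _ hmem]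
    · rw [Set.indicator_of_mem]
      rfl
    · intro i _ hi
      exact Set.indicator_of_notMem (fun h => hi h.symm) _
  have hsig : Measurable fun t : ℝ => (σ ⌊Q * t⌋₊ : ℂ) :=
    (measurable_from_nat (f := fun i => (σ i : ℂ))).comp
      (Nat.measurable_floor.comp (measurable_const_mul Q))
  have hi1 : IntegrableOn (fun t => (1 / 2 : ℂ) * (G j (x t) + G j (x t + δ)))
      (Set.Ico (0 : ℝ) 1) := by
    refine Measure.integrableOn_of_bounded (M := B j) (by simp)
      ((((hG j).comp hx).add ((hG j).comp (hx.add_const δ))).const_mul _).aestronglyMeasurable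
      (ae_of_all _ fun t => ?_)
    have h1 := hB j (x t) (hx1 t)
    have h2 := hB j (x t + δ) (by linarith [hx1 t])
    have h3 := norm_add_le (G j (x t)) (G j (x t + δ))
    rw [norm_mul]
    norm_num
    linarith
  have hi2 : IntegrableOn (fun t => (σ ⌊Q * t⌋₊ : ℂ) * w j t) (Set.Ico (0 : ℝ) 1) := by
    refine Measure.integrableOn_of_bounded (M := B j) (by simp)
      (hsig.mul (hwm j)).aestronglyMeasurable (ae_of_all _ fun t => ?_)
    rw [norm_mul]
    rcases hσ ⌊Q * t⌋₊ with h | h <;> simpa [h] using hwB j t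
  simp only [hpt]
  rw [integral_add hi1 hi2, add_sub_cancel_left, setIntegral_congr_fun measurableSet_Ico hsum,
    integral_finsetSum _ fun i _ => ((hwi j).const_mul _).indicator (hAm i)]
  have heq : ∀ i, ∫ t in Set.Ico (0 : ℝ) 1, (A i).indicator (fun t => (σ i : ℂ) * w j t) t
      = σ i * ∫ t in Set.Ico (0 : ℝ) 1 ∩ A i, w j t := fun i => by
    rw [setIntegral_indicator (hAm i), integral_const_mul]
  simp only [heq]
  refine (hle j hj).trans ?_
  have hN : √((⌊Q⌋₊ + 1 : ℕ) : ℝ) ≤ 2 * √Q := by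
    rw [Real.sqrt_le_left (by positivity), mul_pow, Real.sq_sqrt hQ0.le]
    push_cast
    linarith [Nat.floor_le hQ0.le]
  have hcard : (1 : ℝ) ≤ J.card := by exact_mod_cast Finset.card_pos.2 ⟨j, hj⟩
  have hlog : 0 ≤ Real.log (4 * J.card) + 1 / 2 := by
    have := Real.log_nonneg (show (1 : ℝ) ≤ 4 * J.card by linarith)
    linarith
  calc 2 * (B j / Q * (√((⌊Q⌋₊ + 1 : ℕ) : ℝ) * (Real.log (4 * J.card) + 1 / 2)))
      ≤ 2 * (B j / Q * (2 * √Q * (Real.log (4 * J.card) + 1 / 2))) := by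
        have := hB0 j
        gcongr
    _ = _ := by
        have : B j / Q = B j / √Q / √Q := by
          rw [div_div, Real.mul_self_sqrt hQ0.le]
        rw [this]
        have := (Real.sqrt_pos.2 hQ0).ne'
        field_simp
        ring

/-- Partial sums of a binary expansion starting at `1` whose `k`-th digit at `t` depends only on
`⌊q ^ k * t⌋`. -/
noncomputable def digitSum (q : ℝ) (s : ℕ → ℕ → ℝ) (k : ℕ) (t : ℝ) : ℝ :=
  1 + ∑ i ∈ Finset.range k, (1 / 2) ^ (i + 1) * s i ⌊q ^ (i + 1) * t⌋₊

theorem digitSum_succ (q : ℝ) (s : ℕ → ℕ → ℝ) (k : ℕ) (t : ℝ) :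
    digitSum q s (k + 1) t = digitSum q s k t + (1 / 2) ^ (k + 1) * s k ⌊q ^ (k + 1) * t⌋₊ := by
  rw [digitSum, Finset.sum_range_succ, ← add_assoc, digitSum]

theorem measurable_digitSum (q : ℝ) (s : ℕ → ℕ → ℝ) (k : ℕ) : Measurable (digitSum q s k) := by
  refine measurable_const.add (Finset.measurable_fun_sum _ fun i _ => Measurable.const_mul ?_ _)
  exact (measurable_from_nat (f := s i)).comp
    (Nat.measurable_floor.comp (measurable_const_mul (q ^ (i + 1))))

theorem exists_digits {ι : Type*} (J : ℕ → Finset ι) (g : ι → ℕ → ℝ → ℂ) (B : ι → ℕ → ℝ)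
    (hg : ∀ j k, Measurable (g j k)) (hB : ∀ j k x, 1 ≤ x → ‖g j k x‖ ≤ B j k)
    (hsplit : ∀ j k x, g j k x = (1 / 2 : ℂ) * (g j (k + 1) x + g j (k + 1) (x + (1 / 2) ^ (k + 1))))
    {q : ℝ} (hq : 1 ≤ q) :
    ∃ s : ℕ → ℕ → ℝ, (∀ k i, s k i = 0 ∨ s k i = 1) ∧ ∀ k, ∀ j ∈ J k,
      ‖(∫ t in Set.Ico (0 : ℝ) 1, g j (k + 1) (digitSum q s (k + 1) t))
        - ∫ t in Set.Ico (0 : ℝ) 1, g j k (digitSum q s k t)‖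
        ≤ 4 * (Real.log (4 * (J k).card) + 1 / 2) * (B j (k + 1) / √(q ^ (k + 1))) := by
  have step : ∀ k (x : ℝ → ℝ), ∃ s : ℕ → ℝ, (∀ i, s i = 0 ∨ s i = 1) ∧
      (Measurable x → (∀ t, 1 ≤ x t) → ∀ j ∈ J k,
      ‖(∫ t in Set.Ico (0 : ℝ) 1, g j (k + 1) (x t + (1 / 2) ^ (k + 1) * s ⌊q ^ (k + 1) * t⌋₊))
        - ∫ t in Set.Ico (0 : ℝ) 1, g j k (x t)‖
        ≤ 4 * (Real.log (4 * (J k).card) + 1 / 2) * (B j (k + 1) / √(q ^ (k + 1)))) := by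
    intro k x
    by_cases h : Measurable x ∧ ∀ t, 1 ≤ x t
    · obtain ⟨s, hs, hle⟩ := exists_digit_step (J k) (fun j => g j (k + 1)) (fun j => B j (k + 1))
        (fun j => hg j _) (fun j => hB j _) (one_le_pow₀ hq (n := k + 1))
        (δ := (1 / 2) ^ (k + 1)) (by positivity) x h.1 h.2
      refine ⟨s, hs, fun _ _ j hj => ?_⟩
      simp only [hsplit j k]
      exact hle j hj
    · exact ⟨fun _ => 0, fun _ => Or.inl rfl, fun h1 h2 => absurd ⟨h1, h2⟩ h⟩
  choose S hS hSle using step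
  let X : ℕ → ℝ → ℝ := fun k => Nat.rec (fun _ => 1)
    (fun k x t => x t + (1 / 2) ^ (k + 1) * S k x ⌊q ^ (k + 1) * t⌋₊) k
  have hX : ∀ k, X k = digitSum q (fun k => S k (X k)) k := by
    intro k
    induction k with
    | zero => ext t; simp [X, digitSum]
    | succ k ih =>
      ext t
      rw [digitSum_succ, ← ih]
  refine ⟨fun k => S k (X k), fun k i => hS _ _ i, fun k j hj => ?_⟩
  have h1 : ∀ t, 1 ≤ X k t := fun t => by
    rw [hX, digitSum]
    have : 0 ≤ ∑ i ∈ Finset.range k, (1 / 2 : ℝ) ^ (i + 1) * S i (X i) ⌊q ^ (i + 1) * t⌋₊ :=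
      Finset.sum_nonneg fun i _ => mul_nonneg (by positivity)
        (by rcases hS i (X i) ⌊q ^ (i + 1) * t⌋₊ with h | h <;> simp [h])
    linarith
  have h2 : Measurable (X k) := by
    rw [hX]
    exact measurable_digitSum _ _ _
  have := hSle k (X k) h2 h1 j hj
  simp only [digitSum_succ, ← hX]
  exact this

/-- The sum of the binary expansion approximated by `digitSum`. -/
noncomputable def digitLim (q : ℝ) (s : ℕ → ℕ → ℝ) (t : ℝ) : ℝ :=
  1 + ∑' i, (1 / 2 : ℝ) ^ (i + 1) * s i ⌊q ^ (i + 1) * t⌋₊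

section digits

variable {q : ℝ} {s : ℕ → ℕ → ℝ}

theorem digitLim_mem_Icc (hs : ∀ k i, s k i = 0 ∨ s k i = 1) (k : ℕ) (t : ℝ) :
    digitLim q s t ∈ Set.Icc (digitSum q s k t) (digitSum q s k t + (1 / 2) ^ k) := by
  have h0 : ∀ i, 0 ≤ (1 / 2 : ℝ) ^ (i + 1) * s i ⌊q ^ (i + 1) * t⌋₊ := fun i =>
    mul_nonneg (by positivity) (by rcases hs i ⌊q ^ (i + 1) * t⌋₊ with h | h <;> simp [h])
  have h1 : ∀ i, (1 / 2 : ℝ) ^ (i + 1) * s i ⌊q ^ (i + 1) * t⌋₊ ≤ (1 / 2) ^ (i + 1) := fun i => by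
    rcases hs i ⌊q ^ (i + 1) * t⌋₊ with h | h <;> simp [h]
  have hgeom : ∀ k : ℕ, HasSum (fun i : ℕ => (1 / 2 : ℝ) ^ (i + k + 1)) ((1 / 2) ^ k) := fun k => by
    have := (hasSum_geometric_two).mul_left ((1 / 2 : ℝ) ^ (k + 1))
    have h2 : (1 / 2 : ℝ) ^ (k + 1) * 2 = (1 / 2) ^ k := by ring
    have h3 : (fun i : ℕ => (1 / 2 : ℝ) ^ (i + k + 1)) = fun i => (1 / 2) ^ (k + 1) * (1 / 2) ^ i :=
      funext fun i => by ring
    rw [h3, ← h2]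
    exact this
  have hsum : Summable fun i => (1 / 2 : ℝ) ^ (i + 1) * s i ⌊q ^ (i + 1) * t⌋₊ :=
    Summable.of_nonneg_of_le h0 h1 (hgeom 0).summable
  rw [digitLim, ← hsum.sum_add_tsum_nat_add k, digitSum, add_assoc]
  have h2 : 0 ≤ ∑' i, (1 / 2 : ℝ) ^ (i + k + 1) * s (i + k) ⌊q ^ (i + k + 1) * t⌋₊ :=
    tsum_nonneg fun i => h0 (i + k)
  have h3 : ∑' i, (1 / 2 : ℝ) ^ (i + k + 1) * s (i + k) ⌊q ^ (i + k + 1) * t⌋₊ ≤ (1 / 2) ^ k :=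
    (((summable_nat_add_iff k).2 hsum).tsum_le_tsum (fun i => h1 (i + k))
      (hgeom k).summable).trans_eq (hgeom k).tsum_eq
  exact ⟨by linarith, by linarith⟩

theorem one_le_digitSum (hs : ∀ k i, s k i = 0 ∨ s k i = 1) (k : ℕ) (t : ℝ) :
    1 ≤ digitSum q s k t := by
  have : 0 ≤ ∑ i ∈ Finset.range k, (1 / 2 : ℝ) ^ (i + 1) * s i ⌊q ^ (i + 1) * t⌋₊ :=
    Finset.sum_nonneg fun i _ => mul_nonneg (by positivity)
      (by rcases hs i ⌊q ^ (i + 1) * t⌋₊ with h | h <;> simp [h])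
  rw [digitSum]
  linarith

theorem digitLim_mem_Icc_one_two (hs : ∀ k i, s k i = 0 ∨ s k i = 1) (t : ℝ) :
    digitLim q s t ∈ Set.Icc (1 : ℝ) 2 := by
  have := digitLim_mem_Icc (q := q) hs 0 t
  simp only [digitSum, Finset.range_zero, Finset.sum_empty, pow_zero] at this
  norm_num at this ⊢
  exact this

theorem tendsto_digitSum (hs : ∀ k i, s k i = 0 ∨ s k i = 1) (t : ℝ) :
    Filter.Tendsto (fun k => digitSum q s k t) Filter.atTop (nhds (digitLim q s t)) := by
  have h : Filter.Tendsto (fun k : ℕ => digitLim q s t - (1 / 2) ^ k) Filter.atTop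
      (nhds (digitLim q s t - 0)) :=
    tendsto_const_nhds.sub (tendsto_pow_atTop_nhds_zero_of_lt_one (by norm_num) (by norm_num))
  rw [sub_zero] at h
  refine tendsto_of_tendsto_of_tendsto_of_le_of_le h tendsto_const_nhds (fun k => ?_) fun k => ?_
  · linarith [(digitLim_mem_Icc (q := q) hs k t).2]
  · exact (digitLim_mem_Icc hs k t).1

theorem measurable_digitLim (hs : ∀ k i, s k i = 0 ∨ s k i = 1) : Measurable (digitLim q s) :=
  measurable_of_tendsto_metrizable (measurable_digitSum q s)
    (tendsto_pi_nhds.2 fun t => tendsto_digitSum hs t)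

theorem exists_finset_digitSum_mem (hq : 1 ≤ q) (s : ℕ → ℕ → ℝ) (k : ℕ) :
    ∃ F : Finset ℝ, (F.card : ℝ) ≤ (k + 1) * q ^ k ∧
      ∀ t ∈ Set.Ico (0 : ℝ) 1, digitSum q s k t ∈ F := by
  classical
  set T : ℝ → ℕ := fun t => ∑ i ∈ Finset.range k, ⌊q ^ (i + 1) * t⌋₊ with hT
  have hmono : ∀ i, Monotone fun t : ℝ => ⌊q ^ (i + 1) * t⌋₊ := fun i t t' h =>
    Nat.floor_le_floor (by gcongr)
  have hfac : ∀ t t', t ≤ t' → T t = T t' → digitSum q s k t = digitSum q s k t' := by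
    intro t t' h hTT
    have := (Finset.sum_eq_sum_iff_of_le fun i _ => hmono i h).1 hTT
    rw [digitSum, digitSum]
    congr 1
    exact Finset.sum_congr rfl fun i hi => by rw [show ⌊q ^ (i + 1) * t⌋₊ = _ from this i hi]
  have hfac' : ∀ t t', T t = T t' → digitSum q s k t = digitSum q s k t' := fun t t' h => by
    rcases le_total t t' with h' | h'
    · exact hfac t t' h' h
    · exact (hfac t' t h' h.symm).symm
  set M := ∑ i ∈ Finset.range k, ⌊q ^ (i + 1)⌋₊ with hM
  let f : ℕ → ℝ := fun m => if h : ∃ t, T t = m then digitSum q s k h.choose else 0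
  refine ⟨(Finset.range (M + 1)).image f, ?_, fun t ht => ?_⟩
  · have h1 : (M : ℝ) ≤ k * q ^ k := by
      rw [hM]
      push_cast
      calc ∑ i ∈ Finset.range k, (⌊q ^ (i + 1)⌋₊ : ℝ) ≤ ∑ i ∈ Finset.range k, q ^ k := by
            refine Finset.sum_le_sum fun i hi => (Nat.floor_le (by positivity)).trans ?_
            exact pow_le_pow_right₀ hq (Finset.mem_range.1 hi)
        _ = k * q ^ k := by simp
    have h2 : (((Finset.range (M + 1)).image f).card : ℝ) ≤ M + 1 := by
      exact_mod_cast (Finset.card_image_le).trans_eq (Finset.card_range _)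
    have := one_le_pow₀ hq (n := k)
    linarith
  · refine Finset.mem_image.2 ⟨T t, ?_, ?_⟩
    · rw [Finset.mem_range, Nat.lt_succ_iff]
      refine Finset.sum_le_sum fun i _ => Nat.floor_le_floor ?_
      exact mul_le_of_le_one_right (by positivity) ht.2.le
    · have h : ∃ t', T t' = T t := ⟨t, rfl⟩
      simp only [f, dif_pos h]
      exact hfac' _ _ h.choose_spec

end digits

/-- A set covered by subexponentially many times `2 ^ (α k)` intervals of length `2 ^ (-k)` has
Hausdorff dimension at most `α`. -/
theorem dimH_le_of_forall_cover (A : Set ℝ) {α : ℝ} (hα : 0 ≤ α)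
    (h : ∀ k : ℕ, ∃ F : Finset ℝ, (F.card : ℝ) ≤ (k + 1) * ((2 : ℝ) ^ α) ^ k ∧
      A ⊆ ⋃ v : F, Set.Icc (v : ℝ) (v + (1 / 2) ^ k)) :
    dimH A ≤ ENNReal.ofReal α := by
  choose F hF hA using h
  refine dimH_le fun d hd => ?_
  by_contra! hlt
  have hd0 : α < d := by
    rw [← ENNReal.ofReal_coe_nnreal] at hlt
    exact (ENNReal.ofReal_lt_ofReal_iff_of_nonneg hα).1 hlt
  have hdiam : ∀ k (v : ℝ), Metric.ediam (Set.Icc v (v + (1 / 2) ^ k))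
      = ENNReal.ofReal ((1 / 2) ^ k) := fun k v => by
    rw [Real.ediam_Icc, add_sub_cancel_left]
  have hpow : Filter.Tendsto (fun k : ℕ => (1 / 2 : ℝ) ^ k) Filter.atTop (nhds 0) :=
    tendsto_pow_atTop_nhds_zero_of_lt_one (by norm_num) (by norm_num)
  have key := Measure.hausdorffMeasure_le_liminf_sum (d : ℝ) A (l := Filter.atTop)
    (fun k : ℕ => ENNReal.ofReal ((1 / 2) ^ k))
    (by simpa using ENNReal.tendsto_ofReal hpow)
    (fun k (v : F k) => Set.Icc (v : ℝ) (v + (1 / 2) ^ k))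
    (Filter.Eventually.of_forall fun k v => (hdiam k v).le)
    (Filter.Eventually.of_forall hA)
  rw [hd] at key
  have hr0 : (0 : ℝ) < 2 ^ (α - d) := by positivity
  have hr1 : (2 : ℝ) ^ (α - d) < 1 := Real.rpow_lt_one_of_one_lt_of_neg (by norm_num) (by linarith)
  have hlim : Filter.Tendsto (fun k : ℕ => ENNReal.ofReal ((k + 1) * ((2 : ℝ) ^ (α - d)) ^ k))
      Filter.atTop (nhds 0) := by
    have h1 := tendsto_self_mul_const_pow_of_lt_one hr0.le hr1
    have h2 := tendsto_pow_atTop_nhds_zero_of_lt_one hr0.le hr1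
    have h3 := h1.add h2
    rw [← ENNReal.ofReal_zero]
    refine ENNReal.tendsto_ofReal ?_
    simpa [add_mul] using h3
  have hle : ∀ k, ∑ v : F k, Metric.ediam (Set.Icc (v : ℝ) (v + (1 / 2) ^ k)) ^ (d : ℝ)
      ≤ ENNReal.ofReal ((k + 1) * ((2 : ℝ) ^ (α - d)) ^ k) := fun k => by
    simp only [hdiam, Finset.sum_const, Finset.card_univ, Fintype.card_coe, nsmul_eq_mul]
    rw [ENNReal.ofReal_rpow_of_pos (by positivity), ← ENNReal.ofReal_natCast,
      ← ENNReal.ofReal_mul (by positivity)]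
    refine ENNReal.ofReal_le_ofReal ?_
    refine (mul_le_mul_of_nonneg_right (hF k) (by positivity)).trans_eq ?_
    rw [mul_assoc]
    congr 1
    rw [← Real.rpow_natCast, ← Real.rpow_natCast, ← Real.rpow_natCast, ← Real.rpow_mul (by norm_num),
      ← Real.rpow_mul (by norm_num), ← Real.rpow_mul (by norm_num), one_div, Real.inv_rpow (by norm_num),
      ← Real.rpow_neg (by norm_num), ← Real.rpow_add (by norm_num)]
    congr 1
    ring
  have hl0 := hlim.liminf_eq
  have := (Filter.liminf_le_liminf (Filter.Eventually.of_forall hle)).trans_eq hl0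
  exact absurd (key.trans this) (by simp)

theorem integrable_abs_rpow_mul_exp_neg_mul_sq {s : ℝ} (hs : -1 < s) {b : ℝ} (hb : 0 < b) :
    Integrable fun x : ℝ => |x| ^ s * Real.exp (-b * x ^ 2) := by
  have h := integrable_rpow_mul_exp_neg_mul_sq hb hs
  refine Integrable.mono' (h.norm.add h.comp_neg.norm) ?_ (ae_of_all _ fun x => ?_)
  · exact (Measurable.mul (measurable_id.abs.pow_const s) (by fun_prop)).aestronglyMeasurable
  · rw [Real.norm_of_nonneg (by positivity)]
    simp only [Pi.add_apply, neg_sq]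
    rcases le_total 0 x with hx | hx
    · rw [abs_of_nonneg hx]
      exact (le_abs_self _).trans (le_add_of_nonneg_right (norm_nonneg _))
    · rw [abs_of_nonpos hx]
      exact (le_abs_self _).trans (le_add_of_nonneg_left (norm_nonneg _))

theorem gaussian_eq_integral {δ : ℝ} (hδ : 0 < δ) (x : ℝ) :
    ((Real.exp (-(Real.pi * x ^ 2 / δ ^ 2)) : ℝ) : ℂ)
      = ∫ ξ : ℝ, ((δ * Real.exp (-(Real.pi * δ ^ 2) * ξ ^ 2) : ℝ) : ℂ)
        * Complex.exp (((-2 * Real.pi * x * ξ : ℝ) : ℂ) * Complex.I) := by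
  have hb : 0 < ((Real.pi * δ ^ 2 : ℝ) : ℂ).re := by
    rw [Complex.ofReal_re]; positivity
  have h := fourierIntegral_gaussian hb ((-2 * Real.pi * x : ℝ) : ℂ)
  have h1 : ((Real.pi : ℂ) / ((Real.pi * δ ^ 2 : ℝ) : ℂ)) ^ (1 / 2 : ℂ) = ((δ⁻¹ : ℝ) : ℂ) := by
    rw [← Complex.ofReal_div, show (1 / 2 : ℂ) = ((1 / 2 : ℝ) : ℂ) by norm_num,
      ← Complex.ofReal_cpow (by positivity)]
    congr 1
    rw [← Real.sqrt_eq_rpow, show Real.pi / (Real.pi * δ ^ 2) = (δ⁻¹) ^ 2 by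
      have := Real.pi_ne_zero
      field_simp]
    exact Real.sqrt_sq (by positivity)
  rw [h1] at h
  have h2 : ∀ ξ : ℝ, ((δ * Real.exp (-(Real.pi * δ ^ 2) * ξ ^ 2) : ℝ) : ℂ)
        * Complex.exp (((-2 * Real.pi * x * ξ : ℝ) : ℂ) * Complex.I)
      = (δ : ℂ) * (Complex.exp (Complex.I * ((-2 * Real.pi * x : ℝ) : ℂ) * ξ)
        * Complex.exp (-((Real.pi * δ ^ 2 : ℝ) : ℂ) * (ξ : ℂ) ^ 2)) := fun ξ => by
    push_cast
    rw [show (-2 * (Real.pi : ℂ) * x * ξ * Complex.I) = Complex.I * (-2 * Real.pi * x) * ξ by ring]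
    ring
  simp only [h2]
  rw [integral_const_mul, h, ← mul_assoc, ← Complex.ofReal_mul, mul_inv_cancel₀ hδ.ne',
    Complex.ofReal_one, one_mul, Complex.ofReal_exp]
  congr 1
  have : (Real.pi : ℂ) ≠ 0 := by exact_mod_cast Real.pi_ne_zero
  have : (δ : ℂ) ≠ 0 := by exact_mod_cast hδ.ne'
  push_cast
  field_simp
  ring

theorem norm_exp_ofReal_mul_I_le (x : ℝ) : ‖Complex.exp ((x : ℂ) * Complex.I)‖ ≤ 1 :=
  (Complex.norm_exp_ofReal_mul_I x).le

theorem integral_gaussian_sub_eq (μ : Measure ℝ) [IsFiniteMeasure μ] {δ : ℝ} (hδ : 0 < δ) :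
    ∫ p, Real.exp (-(Real.pi * (p.1 - p.2) ^ 2 / δ ^ 2)) ∂(μ.prod μ)
      = ∫ ξ : ℝ, δ * Real.exp (-(Real.pi * δ ^ 2) * ξ ^ 2) * ‖ft1 μ ξ‖ ^ 2 := by
  apply Complex.ofReal_injective
  rw [← integral_complex_ofReal, ← integral_complex_ofReal]
  simp only [gaussian_eq_integral hδ]
  rw [integral_integral_swap]
  · congr 1
    ext ξ
    rw [integral_const_mul]
    have h1 : ∀ p : ℝ × ℝ, Complex.exp (((-2 * Real.pi * (p.1 - p.2) * ξ : ℝ) : ℂ) * Complex.I)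
        = Complex.exp (((-2 * Real.pi * p.1 * ξ : ℝ) : ℂ) * Complex.I)
          * (starRingEnd ℂ) (Complex.exp (((-2 * Real.pi * p.2 * ξ : ℝ) : ℂ) * Complex.I)) := by
      intro p
      rw [← Complex.exp_conj, ← Complex.exp_add, map_mul, Complex.conj_I, Complex.conj_ofReal]
      congr 1
      push_cast
      ring
    simp only [h1]
    rw [integral_prod_mul (fun x : ℝ => Complex.exp (((-2 * Real.pi * x * ξ : ℝ) : ℂ) * Complex.I))
      (fun x : ℝ => (starRingEnd ℂ) (Complex.exp (((-2 * Real.pi * x * ξ : ℝ) : ℂ) * Complex.I))),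
      integral_conj, Complex.mul_conj, Complex.normSq_eq_norm_sq]
    simp only [ft1, Complex.ofReal_mul]
  · have hb : 0 < Real.pi * δ ^ 2 := by positivity
    have hi := ((integrable_const (1 : ℝ) (μ := μ.prod μ)).mul_prod
      ((integrable_exp_neg_mul_sq hb).const_mul δ))
    refine hi.mono' (Continuous.aestronglyMeasurable ?_) (ae_of_all _ fun p => ?_)
    · unfold Function.uncurry
      fun_prop
    · simp only [Function.uncurry, norm_mul, one_mul]
      rw [Complex.norm_real, Real.norm_of_nonneg (by positivity)]
      exact mul_le_of_le_one_right (by positivity) (norm_exp_ofReal_mul_I_le _)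

/-- Fourier decay controls the average measure of small balls. -/
theorem exists_integral_measureReal_closedBall_le (μ : Measure ℝ) [IsFiniteMeasure μ] {s C : ℝ}
    (hs1 : s < 1) (hC : ∀ ξ, ‖ft1 μ ξ‖ ^ 2 * |ξ| ^ s ≤ C) :
    ∃ C', ∀ δ, 0 < δ → ∫ x, μ.real (Metric.closedBall x δ) ∂μ ≤ C' * δ ^ s := by
  refine ⟨Real.exp Real.pi * C * ∫ ξ : ℝ, |ξ| ^ (-s) * Real.exp (-Real.pi * ξ ^ 2), fun δ hδ => ?_⟩
  have hgm : Continuous fun p : ℝ × ℝ => Real.exp (-(Real.pi * (p.1 - p.2) ^ 2 / δ ^ 2)) := by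
    fun_prop
  have hgi : Integrable (fun p : ℝ × ℝ => Real.exp (-(Real.pi * (p.1 - p.2) ^ 2 / δ ^ 2)))
      (μ.prod μ) := by
    refine Integrable.of_bound hgm.aestronglyMeasurable 1 (ae_of_all _ fun p => ?_)
    rw [Real.norm_of_nonneg (Real.exp_pos _).le, Real.exp_le_one_iff]
    have : 0 ≤ Real.pi * (p.1 - p.2) ^ 2 / δ ^ 2 := by positivity
    linarith
  set S : Set (ℝ × ℝ) := {p | dist p.2 p.1 ≤ δ} with hS
  have hSm : MeasurableSet S :=
    (isClosed_le (continuous_snd.dist continuous_fst) continuous_const).measurableSet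
  have h1 : ∫ x, μ.real (Metric.closedBall x δ) ∂μ = (μ.prod μ).real S := by
    rw [measureReal_def, Measure.prod_apply hSm, ← integral_toReal]
    · rfl
    · exact (measurable_measure_prodMk_left hSm).aemeasurable
    · exact ae_of_all _ fun x => measure_lt_top _ _
  have h2 : (μ.prod μ).real S
      ≤ ∫ p, Real.exp Real.pi * Real.exp (-(Real.pi * (p.1 - p.2) ^ 2 / δ ^ 2)) ∂(μ.prod μ) := by
    rw [← integral_indicator_one hSm]
    refine integral_mono ((integrable_const (1 : ℝ)).indicator hSm) (hgi.const_mul _) fun p => ?_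
    by_cases hp : p ∈ S
    · rw [Set.indicator_of_mem hp, Pi.one_apply, ← Real.exp_add, Real.one_le_exp_iff]
      have h3 : (p.1 - p.2) ^ 2 ≤ δ ^ 2 := by
        have hp' : dist p.2 p.1 ≤ δ := hp
        rw [Real.dist_eq, abs_sub_comm] at hp'
        exact sq_le_sq' (neg_le_of_abs_le hp') (le_of_abs_le hp')
      have h4 : Real.pi * (p.1 - p.2) ^ 2 / δ ^ 2 ≤ Real.pi := by
        rw [div_le_iff₀ (by positivity)]
        exact mul_le_mul_of_nonneg_left h3 Real.pi_pos.le
      linarith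
    · rw [Set.indicator_of_notMem hp]
      positivity
  rw [h1]
  refine h2.trans ?_
  rw [integral_const_mul, integral_gaussian_sub_eq μ hδ, mul_assoc, mul_assoc]
  refine mul_le_mul_of_nonneg_left ?_ (Real.exp_pos _).le
  have hI := integrable_abs_rpow_mul_exp_neg_mul_sq (s := -s) (by linarith) Real.pi_pos
  have hC0 : ∀ ξ : ℝ, ξ ≠ 0 → ‖ft1 μ ξ‖ ^ 2 ≤ C * |ξ| ^ (-s) := fun ξ hξ => by
    rw [Real.rpow_neg (abs_nonneg _), ← div_eq_mul_inv, le_div_iff₀ (by positivity)]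
    exact hC ξ
  have hscale : ∀ ξ : ℝ, δ * Real.exp (-(Real.pi * δ ^ 2) * ξ ^ 2) * (C * |ξ| ^ (-s))
      = C * δ ^ (s + 1) * (|δ * ξ| ^ (-s) * Real.exp (-Real.pi * (δ * ξ) ^ 2)) := fun ξ => by
    rw [abs_mul, abs_of_pos hδ, Real.mul_rpow hδ.le (abs_nonneg _), Real.rpow_add hδ,
      Real.rpow_neg hδ.le, Real.rpow_one]
    have := (Real.rpow_pos_of_pos hδ s).ne'
    field_simp
  calc ∫ ξ : ℝ, δ * Real.exp (-(Real.pi * δ ^ 2) * ξ ^ 2) * ‖ft1 μ ξ‖ ^ 2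
      ≤ ∫ ξ : ℝ, C * δ ^ (s + 1) * (|δ * ξ| ^ (-s) * Real.exp (-Real.pi * (δ * ξ) ^ 2)) := by
        refine integral_mono_of_nonneg (ae_of_all _ fun ξ => by positivity)
          ((hI.comp_mul_left' hδ.ne').const_mul _) ?_
        filter_upwards [compl_mem_ae_iff.2 (measure_singleton (0 : ℝ))] with ξ hξ
        rw [← hscale]
        exact mul_le_mul_of_nonneg_left (hC0 ξ hξ) (by positivity)
    _ = _ := by
        rw [integral_const_mul, Measure.integral_comp_mul_left
          (fun ξ => |ξ| ^ (-s) * Real.exp (-Real.pi * ξ ^ 2)), abs_of_pos (inv_pos.2 hδ),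
          smul_eq_mul, Real.rpow_add hδ, Real.rpow_one]
        field_simp

theorem norm_ft1_le (μ : Measure ℝ) [IsFiniteMeasure μ] (ξ : ℝ) : ‖ft1 μ ξ‖ ≤ μ.real Set.univ := by
  refine (norm_integral_le_of_norm_le_const (C := 1) (ae_of_all _ fun x =>
    norm_exp_ofReal_mul_I_le _)).trans_eq ?_
  rw [one_mul]

theorem exists_ft1_decay_of_le (μ : Measure ℝ) [IsFiniteMeasure μ] {s s' C : ℝ} (hs' : 0 ≤ s')
    (hss : s' ≤ s) (hC : ∀ ξ, ‖ft1 μ ξ‖ ^ 2 * |ξ| ^ s ≤ C) :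
    ∃ C', ∀ ξ, ‖ft1 μ ξ‖ ^ 2 * |ξ| ^ s' ≤ C' := by
  refine ⟨max C (μ.real Set.univ ^ 2), fun ξ => ?_⟩
  rcases le_total 1 |ξ| with h | h
  · refine le_max_of_le_left (le_trans ?_ (hC ξ))
    gcongr
  · refine le_max_of_le_right ?_
    have h1 := Real.rpow_le_one (abs_nonneg ξ) h hs'
    have h2 := norm_ft1_le μ ξ
    calc ‖ft1 μ ξ‖ ^ 2 * |ξ| ^ s' ≤ μ.real Set.univ ^ 2 * 1 := by gcongr
      _ = _ := mul_one _

/-- The energy bound coming from Fourier decay forces positive Hausdorff measure. -/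
theorem ofReal_le_dimH_of_ft1_decay (μ : Measure ℝ) [IsFiniteMeasure μ] (hμ : μ ≠ 0) {A : Set ℝ}
    (hA : μ Aᶜ = 0) {s C : ℝ} (hs1 : s ≤ 1) (hC : ∀ ξ, ‖ft1 μ ξ‖ ^ 2 * |ξ| ^ s ≤ C) :
    ENNReal.ofReal s ≤ dimH A := by
  by_contra! hlt
  obtain ⟨t, hAt, hts⟩ := ENNReal.lt_iff_exists_nnreal_btwn.1 hlt
  have ht0 : (0 : ℝ) < t := by
    have : (0 : ℝ≥0∞) < t := zero_le.trans_lt hAt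
    exact_mod_cast this
  have hts' : (t : ℝ) < s := by
    rw [← ENNReal.ofReal_coe_nnreal] at hts
    exact (ENNReal.ofReal_lt_ofReal_iff_of_nonneg ht0.le).1 hts
  obtain ⟨s', hts₁, hs's⟩ := exists_between hts'
  obtain ⟨C₁, hC₁⟩ := exists_ft1_decay_of_le μ (ht0.le.trans hts₁.le) hs's.le hC
  obtain ⟨C', hC'⟩ := exists_integral_measureReal_closedBall_le μ (hs's.trans_le hs1) hC₁
  set ρ : ℕ → ℝ := fun j => (1 / 2) ^ j with hρ
  have hρ0 : ∀ j, 0 < ρ j := fun j => by simp only [hρ]; positivity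
  have hρa : Antitone ρ := fun i j h => pow_le_pow_of_le_one (by norm_num) (by norm_num) h
  have hball : ∀ δ : ℝ, Measurable fun x => μ.real (Metric.closedBall x δ) := fun δ =>
    (measurable_measure_prodMk_left (ν := μ) (s := {p : ℝ × ℝ | dist p.2 p.1 ≤ δ})
      (isClosed_le (continuous_snd.dist continuous_fst) continuous_const).measurableSet).ennreal_toReal
  set E : ℕ → Set ℝ := fun j => {x | ρ (j + 1) ^ (t : ℝ) ≤ μ.real (Metric.closedBall x (ρ j))}
    with hE
  have hEm : ∀ j, MeasurableSet (E j) := fun j => measurableSet_le measurable_const (hball _)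
  set r : ℝ := (1 / 2) ^ (s' - t) with hr
  have hr0 : 0 < r := by positivity
  have hr1 : r < 1 := Real.rpow_lt_one (by norm_num) (by norm_num) (by linarith)
  have hEle : ∀ j, μ.real (E j) ≤ C' * 2 ^ (t : ℝ) * r ^ j := fun j => by
    have h1 := mul_meas_ge_le_integral_of_nonneg (μ := μ)
      (f := fun x => μ.real (Metric.closedBall x (ρ j))) (ae_of_all _ fun x => measureReal_nonneg)
      (Integrable.of_bound (hball _).aestronglyMeasurable (μ.real Set.univ) (ae_of_all _ fun x => by
        rw [Real.norm_of_nonneg measureReal_nonneg]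
        exact measureReal_mono (Set.subset_univ _))) (ρ (j + 1) ^ (t : ℝ))
    have h2 := h1.trans (hC' (ρ j) (hρ0 j))
    have h3 : C' * ρ j ^ s' = ρ (j + 1) ^ (t : ℝ) * (C' * 2 ^ (t : ℝ) * r ^ j) := by
      have h4 : ρ (j + 1) ^ (t : ℝ) * 2 ^ (t : ℝ) = ρ j ^ (t : ℝ) := by
        rw [← Real.mul_rpow (hρ0 _).le (by norm_num)]
        congr 1
        simp only [hρ]
        ring
      have h5 : ρ j ^ s' = ρ j ^ (t : ℝ) * r ^ j := by
        rw [hr, ← Real.rpow_natCast, ← Real.rpow_mul (by norm_num), mul_comm (s' - t),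
          Real.rpow_mul (by norm_num), Real.rpow_natCast, ← Real.rpow_add (hρ0 j)]
        congr 1
        ring
      rw [h5, ← h4]
      ring
    rw [h3] at h2
    exact le_of_mul_le_mul_left h2 (Real.rpow_pos_of_pos (hρ0 _) _)
  have hsum : Summable fun j => C' * 2 ^ (t : ℝ) * r ^ j :=
    (summable_geometric_of_lt_one hr0.le hr1).mul_left _
  have hpos : 0 < μ.real Set.univ := by
    rw [measureReal_def]
    exact ENNReal.toReal_pos (by simpa using hμ) (measure_ne_top _ _)
  obtain ⟨J, hJ⟩ := ((tendsto_sum_nat_add fun j => C' * 2 ^ (t : ℝ) * r ^ j).eventually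
    (gt_mem_nhds hpos)).exists
  set G : Set ℝ := (⋃ j, E (j + J))ᶜ with hG
  have hGm : MeasurableSet G := (MeasurableSet.iUnion fun j => hEm _).compl
  have hGpos : μ G ≠ 0 := by
    intro h0
    have h1 : μ Set.univ ≤ ENNReal.ofReal (∑' j, C' * 2 ^ (t : ℝ) * r ^ (j + J)) := by
      calc μ Set.univ ≤ μ (⋃ j, E (j + J)) + μ G := by
            rw [hG]
            exact (measure_add_measure_compl (MeasurableSet.iUnion fun j => hEm _)).ge
        _ ≤ ∑' j, μ (E (j + J)) := by
            rw [h0, add_zero]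
            exact measure_iUnion_le _
        _ ≤ ∑' j, ENNReal.ofReal (C' * 2 ^ (t : ℝ) * r ^ (j + J)) := by
            refine ENNReal.tsum_le_tsum fun j => ?_
            rw [← ofReal_measureReal]
            exact ENNReal.ofReal_le_ofReal (hEle _)
        _ = _ := by
            refine (ENNReal.ofReal_tsum_of_nonneg (fun j => ?_) ?_).symm
            · exact measureReal_nonneg.trans (hEle _)
            · exact (summable_nat_add_iff J).2 hsum
    rw [← ofReal_measureReal] at h1
    have h2 := (ENNReal.ofReal_lt_ofReal_iff hpos).2 hJ
    exact absurd h1 (not_le.2 h2)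
  have hmass : ∀ U : Set ℝ, Metric.ediam U ≤ ENNReal.ofReal (ρ J) →
      μ.restrict G U ≤ Metric.ediam U ^ (t : ℝ) := by
    intro U hU
    rw [Measure.restrict_apply' hGm]
    rcases (U ∩ G).eq_empty_or_nonempty with hempty | ⟨x, hxU, hxG⟩
    · simp [hempty]
    have hscale : ∀ n, J ≤ n → Metric.ediam U ≤ ENNReal.ofReal (ρ n) →
        μ (U ∩ G) ≤ ENNReal.ofReal (ρ (n + 1) ^ (t : ℝ)) := by
      intro n hn hUn
      have hsub : U ∩ G ⊆ Metric.closedBall x (ρ n) := fun y hy => by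
        have h1 := (Metric.edist_le_ediam_of_mem hy.1 hxU).trans hUn
        rw [edist_dist] at h1
        exact (ENNReal.ofReal_le_ofReal_iff (hρ0 n).le).1 h1
      have hxE : x ∉ E n := fun h => hxG (Set.mem_iUnion.2 ⟨n - J, by rwa [Nat.sub_add_cancel hn]⟩)
      have h2 : μ.real (Metric.closedBall x (ρ n)) < ρ (n + 1) ^ (t : ℝ) := not_le.1 hxE
      refine (measure_mono hsub).trans ?_
      rw [← ofReal_measureReal]
      exact ENNReal.ofReal_le_ofReal h2.le
    have hfin : Metric.ediam U ≠ ⊤ := (hU.trans_lt ENNReal.ofReal_lt_top).ne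
    obtain ⟨d, hd0, hd⟩ : ∃ d : ℝ, 0 ≤ d ∧ Metric.ediam U = ENNReal.ofReal d :=
      ⟨_, ENNReal.toReal_nonneg, (ENNReal.ofReal_toReal hfin).symm⟩
    rw [hd] at hU hscale ⊢
    rcases hd0.eq_or_lt with hd0 | hd0
    · refine le_trans (ge_of_tendsto (x := Filter.atTop) (b := μ (U ∩ G))
        (f := fun n : ℕ => ENNReal.ofReal (ρ (n + 1) ^ (t : ℝ))) (a := 0) ?_ ?_) zero_le
      · have h1 : Filter.Tendsto ρ Filter.atTop (nhds 0) :=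
          tendsto_pow_atTop_nhds_zero_of_lt_one (by norm_num) (by norm_num)
        have h2 := ((h1.comp (Filter.tendsto_add_atTop_nat 1)).rpow_const
          (p := (t : ℝ)) (Or.inr ht0.le))
        rw [Real.zero_rpow ht0.ne'] at h2
        simpa using ENNReal.tendsto_ofReal h2
      · filter_upwards [Filter.eventually_ge_atTop J] with n hn
        exact hscale n hn (by rw [← hd0]; simp)
    · have hdJ : d ≤ ρ J := (ENNReal.ofReal_le_ofReal_iff (hρ0 J).le).1 hU
      obtain ⟨n, hn1, hn2⟩ := exists_nat_pow_near_of_lt_one hd0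
        (hdJ.trans (pow_le_one₀ (by norm_num) (by norm_num))) (y := (1 / 2 : ℝ))
        (by norm_num) (by norm_num)
      have hJn : J ≤ n := by
        by_contra! h
        exact absurd (hn1.trans_le hdJ) (not_lt.2 (hρa h))
      refine (hscale n hJn (ENNReal.ofReal_le_ofReal hn2)).trans ?_
      rw [ENNReal.ofReal_rpow_of_pos hd0]
      exact ENNReal.ofReal_le_ofReal (Real.rpow_le_rpow (hρ0 _).le hn1.le ht0.le)
  have hle := Measure.le_hausdorffMeasure (t : ℝ) (μ.restrict G) (ENNReal.ofReal (ρ J))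
    (ENNReal.ofReal_pos.2 (hρ0 J)) hmass
  have hA0 : μ.restrict G A = 0 := le_antisymm
    ((hle A).trans (hausdorffMeasure_of_dimH_lt hAt).le) zero_le
  apply hGpos
  rw [← Measure.restrict_apply_univ, ← Set.union_compl_self A]
  exact measure_union_null hA0 (Measure.restrict_le_self.absolutelyContinuous hA)

theorem ofReal_fDimS1_le_dimH (A : Set ℝ) : ENNReal.ofReal (fDimS1 A) ≤ dimH A := by
  by_cases hfin : dimH A = ⊤
  · simp [hfin]
  refine ENNReal.ofReal_le_of_le_toReal (Real.sSup_le ?_ ENNReal.toReal_nonneg)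
  rintro s ⟨-, hs1, μ, hμ, hfm, ⟨K, -, hKA, hK⟩, C, hC⟩
  have := ofReal_le_dimH_of_ft1_decay μ hμ
    (measure_mono_null (Set.compl_subset_compl.2 hKA) hK) hs1 hC
  exact (ENNReal.ofReal_le_iff_le_toReal hfin).1 this

theorem one_add_abs_rpow_neg_sub_le {b : ℝ} (hb0 : 0 ≤ b) (hb1 : b ≤ 1) (ξ η : ℝ) :
    (1 + |ξ - η|) ^ (-b) ≤ (1 + |ξ|) ^ (-b) * (1 + |η|) := by
  have h1 : (1 + |ξ|) ^ b ≤ (1 + |ξ - η|) ^ b * (1 + |η|) := by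
    have h2 : 1 + |ξ| ≤ (1 + |ξ - η|) * (1 + |η|) := by
      have h3 : |ξ| ≤ |ξ - η| + |η| := by simpa using abs_add_le (ξ - η) η
      nlinarith [abs_nonneg (ξ - η), abs_nonneg η]
    calc (1 + |ξ|) ^ b ≤ ((1 + |ξ - η|) * (1 + |η|)) ^ b := by gcongr
      _ = (1 + |ξ - η|) ^ b * (1 + |η|) ^ b := Real.mul_rpow (by positivity) (by positivity)
      _ ≤ (1 + |ξ - η|) ^ b * (1 + |η|) := by
        gcongr
        exact Real.rpow_le_self_of_one_le (by linarith [abs_nonneg η]) hb1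
  rw [Real.rpow_neg (by positivity), Real.rpow_neg (by positivity), inv_mul_eq_div,
    inv_le_comm₀ (by positivity) (by positivity), inv_div, div_le_iff₀ (by positivity)]
  exact h1

/-- Fourier decay of a measure is inherited by its products with smooth compactly supported
functions. -/
theorem exists_norm_integral_smooth_mul_le (ν : Measure ℝ) [IsFiniteMeasure ν] {b C : ℝ}
    (hb0 : 0 ≤ b) (hb1 : b ≤ 1) (hC : ∀ ξ, ‖ft1 ν ξ‖ ≤ C * (1 + |ξ|) ^ (-b))
    {ψ : ℝ → ℂ} (hψ : HasCompactSupport ψ) (hd : ContDiff ℝ ((⊤ : ℕ∞) : WithTop ℕ∞) ψ) :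
    ∃ C', ∀ ξ, ‖∫ y, ψ y * Complex.exp (((-2 * Real.pi * y * ξ : ℝ) : ℂ) * Complex.I) ∂ν‖
      ≤ C' * (1 + |ξ|) ^ (-b) := by
  set f : SchwartzMap ℝ ℂ := hψ.toSchwartzMap hd with hf
  have hfψ : ⇑f = ψ := rfl
  set Ψ : SchwartzMap ℝ ℂ := FourierTransform.fourier f with hΨ
  have hinv : ∀ y : ℝ, ψ y
      = ∫ η : ℝ, Complex.exp (((2 * Real.pi * η * y : ℝ) : ℂ) * Complex.I) * Ψ η := fun y => by
    have h1 := f.continuous.fourierInv_fourier_eq f.integrable (by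
      rw [← SchwartzMap.fourier_coe]
      exact Ψ.integrable)
    have h2 := congrFun h1 y
    rw [← SchwartzMap.fourier_coe, Real.fourierInv_eq'] at h2
    rw [← hfψ, ← h2]
    refine integral_congr_ae (ae_of_all _ fun η => ?_)
    simp only [smul_eq_mul, RCLike.inner_apply, conj_trivial]
    rw [← hΨ]
    congr 4
    ring
  have hint1 : Integrable fun η : ℝ => ‖Ψ η‖ := Ψ.integrable.norm
  have hint2 : Integrable fun η : ℝ => ‖Ψ η‖ * (1 + |η|) := by
    have h := Ψ.integrable_pow_mul volume 1
    simp only [pow_one, Real.norm_eq_abs] at h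
    refine (hint1.add h).congr (ae_of_all _ fun η => ?_)
    simp only [Pi.add_apply]
    ring
  have hC0 : 0 ≤ C := by
    have := (norm_nonneg _).trans (hC 0)
    simpa using this
  refine ⟨C * ∫ η : ℝ, ‖Ψ η‖ * (1 + |η|), fun ξ => ?_⟩
  have hswap : ∫ y, ψ y * Complex.exp (((-2 * Real.pi * y * ξ : ℝ) : ℂ) * Complex.I) ∂ν
      = ∫ η : ℝ, Ψ η * ft1 ν (ξ - η) := by
    have h1 : ∀ y, ψ y * Complex.exp (((-2 * Real.pi * y * ξ : ℝ) : ℂ) * Complex.I)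
        = ∫ η : ℝ, Ψ η * Complex.exp (((-2 * Real.pi * y * (ξ - η) : ℝ) : ℂ) * Complex.I) := by
      intro y
      rw [hinv y, ← integral_mul_const]
      refine integral_congr_ae (ae_of_all _ fun η => ?_)
      simp only
      rw [mul_comm _ (Ψ η), mul_assoc, ← Complex.exp_add]
      congr 2
      push_cast
      ring
    simp only [h1]
    rw [integral_integral_swap]
    · refine integral_congr_ae (ae_of_all _ fun η => ?_)
      simp only
      rw [integral_const_mul, ft1]
    · have hi := (integrable_const (1 : ℝ) (μ := ν)).mul_prod hint1
      have hΨc := Ψ.continuous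
      refine hi.mono' (Continuous.aestronglyMeasurable ?_) (ae_of_all _ fun p => ?_)
      · unfold Function.uncurry
        fun_prop
      · simp only [Function.uncurry, norm_mul, one_mul]
        exact mul_le_of_le_one_right (norm_nonneg _) (norm_exp_ofReal_mul_I_le _)
  rw [hswap]
  calc ‖∫ η : ℝ, Ψ η * ft1 ν (ξ - η)‖
      ≤ ∫ η : ℝ, C * (1 + |ξ|) ^ (-b) * (‖Ψ η‖ * (1 + |η|)) := by
        refine norm_integral_le_of_norm_le (hint2.const_mul _) (ae_of_all _ fun η => ?_)
        rw [norm_mul]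
        calc ‖Ψ η‖ * ‖ft1 ν (ξ - η)‖
            ≤ ‖Ψ η‖ * (C * ((1 + |ξ|) ^ (-b) * (1 + |η|))) := by
              gcongr
              exact (hC _).trans (by gcongr; exact one_add_abs_rpow_neg_sub_le hb0 hb1 ξ η)
          _ = _ := by ring
    _ = _ := by rw [integral_const_mul]; ring

/-- Decay of the Fourier transform of `ν` and of its averages over short intervals. -/
def HasAverageDecay (ν : Measure ℝ) (b C : ℝ) : Prop :=
  (∀ ξ, ‖ft1 ν ξ‖ ≤ C * (1 + |ξ|) ^ (-b)) ∧
  ∀ x ξ δ : ℝ, 1 ≤ x → 0 < ξ → 0 < δ →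
    ‖∫ z in x..x + δ, ft1 ν (ξ * z)‖ ≤ C * (1 + ξ) ^ (-b) / ξ

theorem intervalIntegral_mul_exp_eq (y ξ : ℝ) (hξ : ξ ≠ 0) (u v : ℝ) :
    ∫ z in u..v, (y : ℂ) * Complex.exp (((-2 * Real.pi * y * (ξ * z) : ℝ) : ℂ) * Complex.I)
      = (Complex.exp (((-2 * Real.pi * y * (ξ * v) : ℝ) : ℂ) * Complex.I)
        - Complex.exp (((-2 * Real.pi * y * (ξ * u) : ℝ) : ℂ) * Complex.I))
        / (-2 * Real.pi * ξ * Complex.I) := by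
  have hπ : (Real.pi : ℂ) ≠ 0 := by exact_mod_cast Real.pi_ne_zero
  have hξ' : (ξ : ℂ) ≠ 0 := by exact_mod_cast hξ
  rw [sub_div]
  refine intervalIntegral.integral_eq_sub_of_hasDerivAt (f := fun z : ℝ =>
    Complex.exp (((-2 * Real.pi * y * (ξ * z) : ℝ) : ℂ) * Complex.I) /
      (-2 * Real.pi * ξ * Complex.I)) (fun z _ => ?_) (Continuous.intervalIntegrable (by fun_prop) _ _)
  have h1 : HasDerivAt (fun z : ℝ => ((-2 * Real.pi * y * (ξ * z) : ℝ) : ℂ) * Complex.I)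
      (((-2 * Real.pi * y * ξ : ℝ) : ℂ) * Complex.I) z := by
    refine (HasDerivAt.ofReal_comp ?_).mul_const _
    have := ((hasDerivAt_id z).const_mul ξ).const_mul (-2 * Real.pi * y)
    simpa using this
  refine (h1.cexp.div_const _).congr_deriv ?_
  rw [div_eq_iff (by simp [hπ, hξ'])]
  push_cast
  ring

theorem continuous_ft1 (ν : Measure ℝ) [IsFiniteMeasure ν] : Continuous (ft1 ν) := by
  unfold ft1
  refine continuous_of_dominated (bound := fun _ => 1) (fun ξ => ?_) (fun ξ => ?_)
    (integrable_const _) (ae_of_all _ fun x => ?_)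
  · exact Continuous.aestronglyMeasurable (by fun_prop)
  · exact ae_of_all _ fun x => norm_exp_ofReal_mul_I_le _
  · fun_prop

/-- A measure with Fourier decay which is not concentrated at the origin can be localized away from
the origin so that the averages of its Fourier transform decay as well. -/
theorem exists_hasAverageDecay (ν₀ : Measure ℝ) [IsFiniteMeasure ν₀] (hν₀ : ν₀ {0}ᶜ ≠ 0) {b C : ℝ}
    (hb0 : 0 ≤ b) (hb1 : b ≤ 1) (hC : ∀ ξ, ‖ft1 ν₀ ξ‖ ≤ C * (1 + |ξ|) ^ (-b)) :
    ∃ ν : Measure ℝ, IsFiniteMeasure ν ∧ ν ≠ 0 ∧ ν ≪ ν₀ ∧ ∃ C', HasAverageDecay ν b C' := by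
  obtain ⟨y₀, hy₀, hpos⟩ := exists_mem_forall_mem_nhdsWithin_pos_measure hν₀
  have hy₀' : y₀ ≠ 0 := hy₀
  have hpos' : ∀ t ∈ nhds y₀, 0 < ν₀ t := fun t ht => hpos t (mem_nhdsWithin_of_mem_nhds ht)
  let φ : ContDiffBump y₀ := ⟨|y₀| / 4, |y₀| / 2, by positivity, by
    have : 0 < |y₀| := by positivity
    linarith⟩
  set σ : ℝ := ((SignType.sign y₀ : SignType) : ℝ) with hσ
  have hσ1 : |σ| = 1 := by
    rcases lt_or_gt_of_ne hy₀' with h | h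
    · simp [hσ, sign_neg h]
    · simp [hσ, sign_pos h]
  set w : ℝ → ℝ := fun y => σ * y * φ y with hw
  have hwc : Continuous w := by
    have := φ.continuous
    fun_prop
  have hball : ∀ y, |y - y₀| < |y₀| / 2 → 0 < σ * y := fun y hy => by
    rcases lt_or_gt_of_ne hy₀' with h | h
    · rw [abs_of_neg h, abs_lt] at hy
      simp only [hσ, sign_neg h]
      simp
      linarith [hy.2]
    · rw [abs_of_pos h, abs_lt] at hy
      simp only [hσ, sign_pos h]
      simp
      linarith [hy.1]
  have hw0 : ∀ y, 0 ≤ w y := fun y => by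
    by_cases hy : |y - y₀| < |y₀| / 2
    · exact mul_nonneg (hball y hy).le φ.nonneg
    · have : φ y = 0 := φ.zero_of_le_dist (by rw [Real.dist_eq]; exact not_lt.1 hy)
      simp [hw, this]
  have hwsupp : HasCompactSupport w := φ.hasCompactSupport.mul_left
  have hwpos : ∀ y, |y - y₀| < |y₀| / 2 → 0 < w y := fun y hy =>
    mul_pos (hball y hy) (φ.pos_of_mem_ball (by rwa [Metric.mem_ball, Real.dist_eq]))
  have hwint : Integrable w ν₀ := hwc.integrable_of_hasCompactSupport hwsupp
  set ν : Measure ℝ := ν₀.withDensity fun y => ENNReal.ofReal (w y) with hν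
  have hνfin : IsFiniteMeasure ν := isFiniteMeasure_withDensity_ofReal hwint.2
  have hνint : ∀ g : ℝ → ℂ, ∫ y, g y ∂ν = ∫ y, (w y : ℂ) * g y ∂ν₀ := fun g => by
    rw [hν, integral_withDensity_eq_integral_toReal_smul (by fun_prop)
      (ae_of_all _ fun _ => ENNReal.ofReal_lt_top)]
    refine integral_congr_ae (ae_of_all _ fun y => ?_)
    simp only
    rw [ENNReal.toReal_ofReal (hw0 y), Complex.real_smul]
  have hφd : ContDiff ℝ ((⊤ : ℕ∞) : WithTop ℕ∞) fun y => ((φ y : ℝ) : ℂ) :=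
    Complex.ofRealCLM.contDiff.comp φ.contDiff
  have hφs : HasCompactSupport fun y => ((φ y : ℝ) : ℂ) :=
    φ.hasCompactSupport.comp_left (g := fun x : ℝ => (x : ℂ)) Complex.ofReal_zero
  have hwd : ContDiff ℝ ((⊤ : ℕ∞) : WithTop ℕ∞) fun y => ((w y : ℝ) : ℂ) :=
    Complex.ofRealCLM.contDiff.comp ((contDiff_const.mul contDiff_id).mul φ.contDiff)
  have hws : HasCompactSupport fun y => ((w y : ℝ) : ℂ) :=
    hwsupp.comp_left (g := fun x : ℝ => (x : ℂ)) Complex.ofReal_zero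
  obtain ⟨C₁, hC₁⟩ := exists_norm_integral_smooth_mul_le ν₀ hb0 hb1 hC hφs hφd
  obtain ⟨C₂, hC₂⟩ := exists_norm_integral_smooth_mul_le ν₀ hb0 hb1 hC hws hwd
  have hC₁0 : 0 ≤ C₁ := by
    have := (norm_nonneg _).trans (hC₁ 0)
    simpa using this
  refine ⟨ν, hνfin, ?_, withDensity_absolutelyContinuous _ _, max C₁ C₂, fun ξ => ?_,
    fun x ξ δ hx hξ hδ => ?_⟩
  · intro h0
    have h1 : ν (Metric.ball y₀ (|y₀| / 2)) = 0 := by rw [h0]; rfl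
    rw [hν, withDensity_apply_eq_zero (by fun_prop)] at h1
    refine (hpos' (Metric.ball y₀ (|y₀| / 2)) (Metric.ball_mem_nhds _ (by positivity))).ne' ?_
    refine measure_mono_null (Set.subset_inter (fun y hy => ?_) subset_rfl) h1
    rw [Metric.mem_ball, Real.dist_eq] at hy
    exact (ENNReal.ofReal_pos.2 (hwpos y hy)).ne'
  · rw [ft1, hνint]
    exact (hC₂ ξ).trans (by gcongr; exact le_max_right _ _)
  · have hbd : ∀ z, 1 ≤ z → ‖∫ y, ((φ y : ℝ) : ℂ)
        * Complex.exp (((-2 * Real.pi * y * (ξ * z) : ℝ) : ℂ) * Complex.I) ∂ν₀‖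
        ≤ C₁ * (1 + ξ) ^ (-b) := fun z hz => by
      refine (hC₁ (ξ * z)).trans ?_
      refine mul_le_mul_of_nonneg_left ?_ hC₁0
      refine Real.rpow_le_rpow_of_nonpos (by positivity) ?_ (by linarith)
      rw [abs_of_pos (by positivity)]
      nlinarith
    have hei : ∀ z : ℝ, Integrable (fun y => ((φ y : ℝ) : ℂ)
        * Complex.exp (((-2 * Real.pi * y * (ξ * z) : ℝ) : ℂ) * Complex.I)) ν₀ := fun z => by
      refine Integrable.of_bound (Continuous.aestronglyMeasurable ?_) 1 (ae_of_all _ fun y => ?_)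
      · have := φ.continuous
        fun_prop
      · rw [norm_mul, Complex.norm_real, Real.norm_of_nonneg φ.nonneg]
        exact mul_le_one₀ φ.le_one (norm_nonneg _) (norm_exp_ofReal_mul_I_le _)
    have hswap : ∫ z in x..x + δ, ft1 ν (ξ * z)
        = (σ / (-2 * Real.pi * ξ * Complex.I)) * ((∫ y, ((φ y : ℝ) : ℂ)
          * Complex.exp (((-2 * Real.pi * y * (ξ * (x + δ)) : ℝ) : ℂ) * Complex.I) ∂ν₀)
          - ∫ y, ((φ y : ℝ) : ℂ)
          * Complex.exp (((-2 * Real.pi * y * (ξ * x) : ℝ) : ℂ) * Complex.I) ∂ν₀) := by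
      simp only [ft1, hνint]
      rw [intervalIntegral_integral_swap]
      · rw [← integral_sub (hei _) (hei _), ← integral_const_mul]
        refine integral_congr_ae (ae_of_all _ fun y => ?_)
        simp only
        have h1 := intervalIntegral_mul_exp_eq y ξ hξ.ne' x (x + δ)
        calc _ = ∫ z in x..x + δ, ((σ * φ y : ℝ) : ℂ) * ((y : ℂ)
              * Complex.exp (((-2 * Real.pi * y * (ξ * z) : ℝ) : ℂ) * Complex.I)) := by
              congr 1
              ext z
              simp only [hw]
              push_cast
              ring
          _ = _ := by
              rw [intervalIntegral.integral_const_mul, h1]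
              push_cast
              ring
      · have : IsFiniteMeasure (volume.restrict (Set.uIoc x (x + δ))) := by
          rw [Set.uIoc_of_le (by linarith)]
          infer_instance
        have hi := (integrable_const (1 : ℝ) (μ := volume.restrict (Set.uIoc x (x + δ)))).mul_prod
          hwint
        refine hi.mono' (Continuous.aestronglyMeasurable ?_) (ae_of_all _ fun p => ?_)
        · unfold Function.uncurry
          fun_prop
        · simp only [Function.uncurry, norm_mul, one_mul]
          rw [Complex.norm_real, Real.norm_of_nonneg (hw0 _)]
          exact mul_le_of_le_one_right (hw0 _) (norm_exp_ofReal_mul_I_le _)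
    rw [hswap, norm_mul]
    have hn : ‖(σ / (-2 * Real.pi * ξ * Complex.I) : ℂ)‖ = 1 / (2 * Real.pi * ξ) := by
      rw [norm_div, Complex.norm_real, Real.norm_eq_abs, hσ1]
      simp [abs_of_pos Real.pi_pos, abs_of_pos hξ]
    rw [hn]
    calc 1 / (2 * Real.pi * ξ) * _
        ≤ 1 / (2 * Real.pi * ξ) * (C₁ * (1 + ξ) ^ (-b) + C₁ * (1 + ξ) ^ (-b)) := by
          gcongr
          exact (norm_sub_le _ _).trans (add_le_add (hbd _ (by linarith)) (hbd _ hx))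
      _ = C₁ * (1 + ξ) ^ (-b) / ξ * (1 / Real.pi) := by
          field_simp
          ring
      _ ≤ C₁ * (1 + ξ) ^ (-b) / ξ * 1 := by
          gcongr
          rw [div_le_one Real.pi_pos]
          linarith [Real.pi_gt_three]
      _ ≤ max C₁ C₂ * (1 + ξ) ^ (-b) / ξ := by
          rw [mul_one]
          gcongr
          exact le_max_left _ _

/-- The average of `f` over `[x, x + 2 ^ (-k)]`. -/
noncomputable def dyadicAverage (f : ℝ → ℂ) (k : ℕ) (x : ℝ) : ℂ :=
  2 ^ k * ∫ z in x..x + (1 / 2) ^ k, f z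

theorem continuous_dyadicAverage {f : ℝ → ℂ} (hf : Continuous f) (k : ℕ) :
    Continuous (dyadicAverage f k) := by
  have h1 : ∀ x, dyadicAverage f k x
      = 2 ^ k * ((∫ z in (0 : ℝ)..x + (1 / 2) ^ k, f z) - ∫ z in (0 : ℝ)..x, f z) := fun x => by
    rw [dyadicAverage, intervalIntegral.integral_interval_sub_left
      (hf.intervalIntegrable _ _) (hf.intervalIntegrable _ _)]
  have h2 : Continuous fun x => ∫ z in (0 : ℝ)..x, f z :=
    intervalIntegral.continuous_primitive (fun a b => hf.intervalIntegrable a b) 0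
  simp only [funext h1]
  exact continuous_const.mul ((h2.comp (continuous_id.add continuous_const)).sub h2)

theorem dyadicAverage_eq_half_mul_add {f : ℝ → ℂ} (hf : Continuous f) (k : ℕ) (x : ℝ) :
    dyadicAverage f k x = (1 / 2 : ℂ) * (dyadicAverage f (k + 1) x
      + dyadicAverage f (k + 1) (x + (1 / 2) ^ (k + 1))) := by
  rw [dyadicAverage, dyadicAverage, dyadicAverage, ← mul_add,
    intervalIntegral.integral_add_adjacent_intervals (hf.intervalIntegrable _ _)
      (hf.intervalIntegrable _ _), ← mul_assoc, pow_succ (2 : ℂ)]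
  congr 1
  · ring
  · congr 1
    ring

theorem norm_dyadicAverage_sub_le {f : ℝ → ℂ} (hf : Continuous f) {k : ℕ} {x c : ℝ} {v : ℂ}
    (h : ∀ z ∈ Set.Icc x (x + (1 / 2) ^ k), ‖f z - v‖ ≤ c) : ‖dyadicAverage f k x - v‖ ≤ c := by
  have hpos : (0 : ℝ) < (1 / 2) ^ k := by positivity
  have h2 : (2 : ℂ) ^ k * (((1 / 2) ^ k : ℝ) : ℂ) = 1 := by
    push_cast
    rw [← mul_pow]
    norm_num
  have h1 : dyadicAverage f k x - v = 2 ^ k * ∫ z in x..x + (1 / 2) ^ k, (f z - v) := by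
    rw [intervalIntegral.integral_sub (hf.intervalIntegrable _ _) (by simp), dyadicAverage,
      intervalIntegral.integral_const, mul_sub, add_sub_cancel_left, Complex.real_smul,
      ← mul_assoc, h2, one_mul]
  have h3 := intervalIntegral.norm_integral_le_of_norm_le_const (a := x) (b := x + (1 / 2) ^ k)
    (f := fun z => f z - v) (C := c) fun z hz => by
      rw [Set.uIoc_of_le (by linarith)] at hz
      exact h z (Set.Ioc_subset_Icc_self hz)
  rw [add_sub_cancel_left, abs_of_pos hpos] at h3
  rw [h1, norm_mul, norm_pow, RCLike.norm_ofNat]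
  calc (2 : ℝ) ^ k * _ ≤ 2 ^ k * (c * (1 / 2) ^ k) := by gcongr
    _ = c * (2 * (1 / 2)) ^ k := by rw [mul_pow]; ring
    _ = c := by norm_num

theorem tendsto_dyadicAverage {f : ℝ → ℂ} (hf : Continuous f) {x : ℕ → ℝ} {y : ℝ}
    (h : ∀ k, y ∈ Set.Icc (x k) (x k + (1 / 2) ^ k)) :
    Filter.Tendsto (fun k => dyadicAverage f k (x k)) Filter.atTop (nhds (f y)) := by
  rw [Metric.tendsto_atTop]
  intro ε hε
  obtain ⟨δ, hδ, hfδ⟩ := Metric.continuousAt_iff.1 (hf.continuousAt (x := y)) (ε / 2) (by positivity)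
  obtain ⟨N, hN⟩ := exists_pow_lt_of_lt_one hδ (by norm_num : (1 / 2 : ℝ) < 1)
  refine ⟨N, fun k hk => ?_⟩
  rw [dist_eq_norm]
  refine (norm_dyadicAverage_sub_le hf (c := ε / 2) fun z hz => ?_).trans_lt (by linarith)
  rw [← dist_eq_norm]
  refine (hfδ ?_).le
  have h1 := h k
  have h2 : (1 / 2 : ℝ) ^ k ≤ (1 / 2) ^ N := pow_le_pow_of_le_one (by norm_num) (by norm_num) hk
  rw [Real.dist_eq, abs_lt]
  constructor <;> linarith [h1.1, h1.2, hz.1, hz.2]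

theorem HasAverageDecay.nonneg {ν : Measure ℝ} {b C : ℝ} (h : HasAverageDecay ν b C) : 0 ≤ C := by
  simpa using (norm_nonneg _).trans (h.1 0)

theorem HasAverageDecay.norm_dyadicAverage_le {ν : Measure ℝ} [IsFiniteMeasure ν] {b C : ℝ}
    (h : HasAverageDecay ν b C) (hb : 0 ≤ b) {ξ : ℝ} (hξ : 0 < ξ) (k : ℕ) {x : ℝ} (hx : 1 ≤ x) :
    ‖dyadicAverage (fun z => ft1 ν (ξ * z)) k x‖ ≤ C * ξ ^ (-b) * min 1 (2 ^ k / ξ) := by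
  have hC := h.nonneg
  have hle : (1 + ξ) ^ (-b) ≤ ξ ^ (-b) :=
    Real.rpow_le_rpow_of_nonpos hξ (by linarith) (by linarith)
  rw [mul_min_of_nonneg _ _ (by positivity)]
  refine le_min ?_ ?_
  · rw [← sub_zero (dyadicAverage _ k x), mul_one]
    refine norm_dyadicAverage_sub_le
      ((continuous_ft1 ν).comp (continuous_const.mul continuous_id)) fun z hz => ?_
    rw [sub_zero]
    refine (h.1 (ξ * z)).trans (mul_le_mul_of_nonneg_left ?_ hC)
    refine Real.rpow_le_rpow_of_nonpos hξ ?_ (by linarith)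
    have hz1 : 1 ≤ z := hx.trans hz.1
    rw [abs_of_pos (by positivity)]
    nlinarith
  · rw [dyadicAverage, norm_mul, norm_pow, RCLike.norm_ofNat]
    calc (2 : ℝ) ^ k * _ ≤ 2 ^ k * (C * (1 + ξ) ^ (-b) / ξ) := by
          gcongr
          exact h.2 x ξ _ hx hξ (by positivity)
      _ ≤ 2 ^ k * (C * ξ ^ (-b) / ξ) := by gcongr
      _ = _ := by ring

/-- Summing the increments of the averages: the limit inherits polynomial decay in `ξ`. -/
theorem exists_norm_limit_le {α s b C : ℝ} (hs1 : s ≤ 1) (hα : 0 < α) (hb : 0 ≤ b)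
    (hs : s < α + 2 * b) (hC : 0 ≤ C) (n : ℕ) :
    ∃ D, 0 ≤ D ∧ ∀ ξ, 1 ≤ ξ → ∀ (a : ℕ → ℂ) (L : ℂ), Filter.Tendsto a Filter.atTop (nhds L) →
      (∀ k, ‖a k‖ ≤ C * ξ ^ (-b) * min 1 (2 ^ k / ξ)) →
      (∀ k, n ≤ k → ξ ≤ 16 ^ k → ‖a (k + 1) - a k‖
        ≤ 40 * (k + 1) * (C * ξ ^ (-b) * min 1 (2 ^ (k + 1) / ξ) / √((2 ^ α) ^ (k + 1)))) →
      ‖L‖ ≤ D * ξ ^ (-(s / 2)) := by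
  set a' : ℝ := max 0 (s / 2 - b) with ha'
  have ha'0 : 0 ≤ a' := le_max_left _ _
  have ha'b : s / 2 ≤ a' + b := by linarith [le_max_right 0 (s / 2 - b)]
  have ha'α : a' < α / 2 := max_lt (by linarith) (by linarith)
  have ha'1 : a' ≤ 1 := max_le (by linarith) (by linarith)
  set r : ℝ := 2 ^ (a' - α / 2) with hr
  have hr0 : 0 < r := by positivity
  have hr1 : r < 1 := Real.rpow_lt_one_of_one_lt_of_neg (by norm_num) (by linarith)
  set e : ℕ → ℝ := fun k => 40 * (((k + 1 : ℕ) : ℝ) * r ^ (k + 1)) + 3 * 4 ^ n * (1 / 2) ^ k with he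
  have he_sum : Summable e := by
    refine Summable.add (Summable.mul_left _ ?_) (Summable.mul_left _ ?_)
    · have h1 := summable_pow_mul_geometric_of_norm_lt_one (R := ℝ) 1 (r := r)
        (by rwa [Real.norm_of_nonneg hr0.le])
      simp only [pow_one] at h1
      exact (summable_nat_add_iff 1).2 h1
    · exact summable_geometric_of_lt_one (by norm_num) (by norm_num)
  have he0 : ∀ k, 0 ≤ e k := fun k => by simp only [he]; positivity
  refine ⟨C * (1 + ∑' k, e k), mul_nonneg hC (add_nonneg zero_le_one (tsum_nonneg he0)),
    fun ξ hξ a L ha hB hd => ?_⟩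
  have hξ0 : 0 < ξ := by linarith
  have hξb : ξ ^ (-b) ≤ 1 := Real.rpow_le_one_of_one_le_of_nonpos hξ (by linarith)
  have hB' : ∀ k, ‖a k‖ ≤ C * (2 ^ k / ξ) := fun k => (hB k).trans <| by
    calc C * ξ ^ (-b) * min 1 (2 ^ k / ξ) ≤ C * 1 * (2 ^ k / ξ) := by
          gcongr
          exact min_le_right _ _
      _ = _ := by ring
  have hhalf : 1 / ξ ≤ ξ ^ (-(s / 2)) := by
    rw [one_div, ← Real.rpow_neg_one]
    exact Real.rpow_le_rpow_of_exponent_le hξ (by linarith)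
  have hstep : ∀ k, ‖a (k + 1) - a k‖ ≤ C * ξ ^ (-(s / 2)) * e k := by
    intro k
    by_cases hk : n ≤ k ∧ ξ ≤ 16 ^ k
    · have hmin : min 1 (2 ^ (k + 1) / ξ) ≤ (2 ^ (k + 1) / ξ) ^ a' := by
        rcases le_total 1 ((2 : ℝ) ^ (k + 1) / ξ) with h | h
        · exact (min_le_left _ _).trans (Real.one_le_rpow h ha'0)
        · refine (min_le_right _ _).trans ?_
          exact Real.self_le_rpow_of_le_one (by positivity) h ha'1
      have hq : √(((2 : ℝ) ^ α) ^ (k + 1)) = (2 ^ (α / 2)) ^ (k + 1) := by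
        rw [Real.sqrt_eq_iff_mul_self_eq (by positivity) (by positivity), ← mul_pow,
          ← Real.rpow_add (by norm_num), add_halves]
      have hrk : ((2 : ℝ) ^ (k + 1)) ^ a' / (2 ^ (α / 2)) ^ (k + 1) = r ^ (k + 1) := by
        rw [hr, Real.rpow_sub (by norm_num), div_pow, ← Real.rpow_natCast, ← Real.rpow_natCast,
          ← Real.rpow_natCast, ← Real.rpow_mul (by norm_num), ← Real.rpow_mul (by norm_num),
          ← Real.rpow_mul (by norm_num), mul_comm a']
      calc ‖a (k + 1) - a k‖
          ≤ 40 * (k + 1) * (C * ξ ^ (-b) * min 1 (2 ^ (k + 1) / ξ) / √((2 ^ α) ^ (k + 1))) :=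
            hd k hk.1 hk.2
        _ ≤ 40 * (k + 1) * (C * ξ ^ (-b) * (2 ^ (k + 1) / ξ) ^ a' / √((2 ^ α) ^ (k + 1))) := by
            gcongr
        _ = C * ξ ^ (-(a' + b)) * (40 * ((k + 1) * r ^ (k + 1))) := by
            rw [hq, ← hrk, Real.div_rpow (by positivity) hξ0.le, neg_add, Real.rpow_add hξ0,
              Real.rpow_neg hξ0.le a']
            ring
        _ ≤ C * ξ ^ (-(s / 2)) * e k := by
            simp only [he]
            push_cast
            gcongr
            exact le_add_of_nonneg_right (by positivity)
    · have h4 : 2 ^ k / ξ ≤ 4 ^ n * (1 / 2) ^ k * ξ ^ (-(s / 2)) := by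
        have h2 : (2 : ℝ) ^ k = 4 ^ k * (1 / 2) ^ k := by
          rw [← mul_pow]
          norm_num
        rcases not_and_or.1 hk with h | h
        · have h5 : (4 : ℝ) ^ k ≤ 4 ^ n := pow_le_pow_right₀ (by norm_num) (by omega)
          rw [div_eq_mul_one_div, h2]
          gcongr
        · have h5 : (4 : ℝ) ^ k ≤ ξ ^ (1 / 2 : ℝ) := by
            rw [← Real.sqrt_eq_rpow]
            refine Real.le_sqrt_of_sq_le ?_
            rw [← pow_mul, mul_comm, pow_mul]
            norm_num
            exact (not_le.1 h).le
          have h6 : (1 : ℝ) ≤ 4 ^ n := one_le_pow₀ (by norm_num)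
          calc 2 ^ k / ξ ≤ ξ ^ (1 / 2 : ℝ) * (1 / 2) ^ k / ξ := by
                rw [h2]
                gcongr
            _ = 1 * (1 / 2) ^ k * ξ ^ (1 / 2 + -1 : ℝ) := by
                rw [Real.rpow_add hξ0, Real.rpow_neg_one]
                ring
            _ ≤ _ := by
                gcongr
                linarith
      calc ‖a (k + 1) - a k‖ ≤ C * (2 ^ (k + 1) / ξ) + C * (2 ^ k / ξ) :=
            (norm_sub_le _ _).trans (add_le_add (hB' _) (hB' _))
        _ = C * (3 * (2 ^ k / ξ)) := by ring
        _ ≤ C * (3 * (4 ^ n * (1 / 2) ^ k * ξ ^ (-(s / 2)))) := by gcongr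
        _ = C * ξ ^ (-(s / 2)) * (3 * 4 ^ n * (1 / 2) ^ k) := by ring
        _ ≤ _ := by
            simp only [he]
            gcongr
            exact le_add_of_nonneg_left (by positivity)
  have h1 := dist_le_tsum_of_dist_le_of_tendsto₀ (f := a) (fun k => C * ξ ^ (-(s / 2)) * e k)
    (fun k => by rw [dist_comm, dist_eq_norm]; exact hstep k) (he_sum.mul_left _) ha
  rw [tsum_mul_left, dist_comm, dist_eq_norm] at h1
  have h2 : ‖a 0‖ ≤ C * ξ ^ (-(s / 2)) := (hB' 0).trans (by rw [pow_zero]; gcongr)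
  calc ‖L‖ = ‖(L - a 0) + a 0‖ := by rw [sub_add_cancel]
    _ ≤ ‖L - a 0‖ + ‖a 0‖ := norm_add_le _ _
    _ ≤ _ := by linarith

/-- Decay along the square roots of the positive integers gives decay everywhere for
Lipschitz functions. -/
theorem exists_norm_sq_mul_rpow_le {F : ℝ → ℂ} {s D l M : ℝ} (hs0 : 0 ≤ s) (hs1 : s ≤ 1)
    (hD : 0 ≤ D) (hl : 0 ≤ l)
    (hF : ∀ m : ℕ, ‖F √(m + 1)‖ ≤ D * √(m + 1) ^ (-(s / 2)))
    (hlip : ∀ ξ η, ‖F ξ - F η‖ ≤ l * |ξ - η|) (hneg : ∀ ξ, ‖F (-ξ)‖ = ‖F ξ‖)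
    (hM : ∀ ξ, ‖F ξ‖ ≤ M) : ∃ C, ∀ ξ, ‖F ξ‖ ^ 2 * |ξ| ^ s ≤ C := by
  refine ⟨max (M ^ 2) ((2 * D + l) ^ 2), fun ξ => ?_⟩
  have habs : ‖F ξ‖ = ‖F |ξ|‖ := by
    rcases abs_choice ξ with h | h <;> rw [h]
    rw [hneg]
  rw [habs]
  generalize hx : |ξ| = x
  have hx0 : 0 ≤ x := hx ▸ abs_nonneg ξ
  rcases le_total x 1 with h1 | h1
  · refine le_max_of_le_left ?_
    calc ‖F x‖ ^ 2 * x ^ s ≤ M ^ 2 * 1 := by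
          gcongr
          · exact hM x
          · exact Real.rpow_le_one hx0 h1 hs0
      _ = _ := mul_one _
  · refine le_max_of_le_right ?_
    have hx0' : 0 < x := by linarith
    obtain ⟨m, hm⟩ : ∃ m, ⌊x ^ 2⌋₊ = m + 1 := Nat.exists_eq_add_one.2
      (Nat.floor_pos.2 (one_le_pow₀ h1))
    have h2 := Nat.floor_le (sq_nonneg x)
    have h3 := Nat.lt_floor_add_one (x ^ 2)
    rw [hm] at h2 h3
    push_cast at h2 h3
    set η : ℝ := √(m + 1) with hη
    have hη2 : η ^ 2 = m + 1 := Real.sq_sqrt (by positivity)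
    have hη0 : 0 ≤ η := Real.sqrt_nonneg _
    have hηx : η ≤ x := by
      refine abs_le_of_sq_le_sq' ?_ hx0 |>.2
      rw [hη2]
      exact h2
    have hxη : x / 2 ≤ η := by
      refine abs_le_of_sq_le_sq' ?_ hη0 |>.2
      rw [hη2]
      have : (0 : ℝ) ≤ m := Nat.cast_nonneg m
      nlinarith
    have hdiff : |x - η| ≤ 1 / x := by
      rw [abs_of_nonneg (by linarith), le_div_iff₀ hx0']
      nlinarith
    have hinv : 1 / x ≤ x ^ (-(s / 2)) := by
      rw [one_div, ← Real.rpow_neg_one]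
      exact Real.rpow_le_rpow_of_exponent_le h1 (by linarith)
    have hηs : η ^ (-(s / 2)) ≤ 2 * x ^ (-(s / 2)) := by
      calc η ^ (-(s / 2)) ≤ (x / 2) ^ (-(s / 2)) :=
            Real.rpow_le_rpow_of_nonpos (by positivity) hxη (by linarith)
        _ = 2 ^ (s / 2) * x ^ (-(s / 2)) := by
            rw [Real.div_rpow hx0 (by norm_num), Real.rpow_neg (by norm_num : (0 : ℝ) ≤ 2),
              div_inv_eq_mul, mul_comm]
        _ ≤ _ := by
            gcongr
            exact Real.rpow_le_self_of_one_le (by norm_num) (by linarith)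
    have hbound : ‖F x‖ ≤ (2 * D + l) * x ^ (-(s / 2)) := by
      calc ‖F x‖ = ‖F η + (F x - F η)‖ := by rw [add_sub_cancel]
        _ ≤ ‖F η‖ + ‖F x - F η‖ := norm_add_le _ _
        _ ≤ D * (2 * x ^ (-(s / 2))) + l * x ^ (-(s / 2)) := by
            refine add_le_add ((hF m).trans (by gcongr)) ((hlip _ _).trans ?_)
            gcongr
            exact hdiff.trans hinv
        _ = _ := by ring
    calc ‖F x‖ ^ 2 * x ^ s ≤ ((2 * D + l) * x ^ (-(s / 2))) ^ 2 * x ^ s := by gcongr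
      _ = (2 * D + l) ^ 2 * (x ^ (-(s / 2)) * x ^ (-(s / 2)) * x ^ s) := by ring
      _ = _ := by
        rw [← Real.rpow_add hx0', ← Real.rpow_add hx0']
        ring_nf
        simp

theorem exists_norm_ft1_sub_le {ν : Measure ℝ} [IsFiniteMeasure ν] {K : Set ℝ} (hK : IsCompact K)
    (hνK : ν Kᶜ = 0) : ∃ l, 0 ≤ l ∧ ∀ ξ η, ‖ft1 ν ξ - ft1 ν η‖ ≤ l * |ξ - η| := by
  obtain ⟨ρ, hρ0, hρ⟩ := hK.isBounded.exists_pos_norm_le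
  refine ⟨2 * Real.pi * ρ * ν.real Set.univ, by positivity, fun ξ η => ?_⟩
  have hi : ∀ ξ : ℝ, Integrable
      (fun x : ℝ => Complex.exp (((-2 * Real.pi * x * ξ : ℝ) : ℂ) * Complex.I)) ν := fun ξ =>
    Integrable.of_bound (Continuous.aestronglyMeasurable (by fun_prop)) 1
      (ae_of_all _ fun x => norm_exp_ofReal_mul_I_le _)
  rw [ft1, ft1, ← integral_sub (hi _) (hi _)]
  have hae : ∀ᵐ x ∂ν, x ∈ K := by
    rw [ae_iff]
    exact hνK
  calc _ ≤ 2 * Real.pi * ρ * |ξ - η| * ν.real Set.univ := by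
        refine norm_integral_le_of_norm_le_const ?_
        filter_upwards [hae] with x hx
        have h1 := Real.norm_exp_I_mul_ofReal_sub_one_le (x := -2 * Real.pi * x * (ξ - η))
        have h2 : Complex.exp (((-2 * Real.pi * x * ξ : ℝ) : ℂ) * Complex.I)
            - Complex.exp (((-2 * Real.pi * x * η : ℝ) : ℂ) * Complex.I)
            = Complex.exp (((-2 * Real.pi * x * η : ℝ) : ℂ) * Complex.I)
              * (Complex.exp (Complex.I * ((-2 * Real.pi * x * (ξ - η) : ℝ) : ℂ)) - 1) := by
          rw [mul_sub, ← Complex.exp_add, mul_one]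
          congr 2
          push_cast
          ring
        rw [h2, norm_mul, Complex.norm_exp_ofReal_mul_I, one_mul]
        refine h1.trans ?_
        rw [norm_mul, norm_mul, norm_mul, norm_neg, Real.norm_ofNat, Real.norm_of_nonneg Real.pi_pos.le,
          Real.norm_eq_abs (ξ - η)]
        gcongr
        exact hρ x hx
    _ = _ := by ring

theorem ft1_neg (ν : Measure ℝ) (ξ : ℝ) : ft1 ν (-ξ) = (starRingEnd ℂ) (ft1 ν ξ) := by
  rw [ft1, ft1, ← integral_conj]
  congr 1
  ext x
  rw [← Complex.exp_conj, map_mul, Complex.conj_I, Complex.conj_ofReal]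
  congr 1
  push_cast
  ring

theorem log_mul_pow_add_half_le (k : ℕ) :
    Real.log (4 * ((k + 1) * 256 ^ k : ℕ)) + 1 / 2 ≤ 10 * (k + 1) := by
  have h1 : (4 * ((k + 1) * 256 ^ k : ℕ) : ℝ) = 2 ^ (8 * k + 2) * (k + 1) := by
    push_cast
    rw [pow_add, pow_mul]
    norm_num
    ring
  rw [h1, Real.log_mul (by positivity) (by positivity), Real.log_pow]
  have h2 := Real.log_le_sub_one_of_pos (x := (k + 1 : ℝ)) (by positivity)
  have h3 := Real.log_two_lt_d9
  have h4 : (0 : ℝ) ≤ k := Nat.cast_nonneg k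
  push_cast
  nlinarith

/-- For countably many measures with decaying averages, there is a single measure on a set of
small dimension all of whose multiplicative convolutions with them gain the full decay. -/
theorem exists_measure_decay {α : ℝ} (hα : 0 < α) (ν : ℕ → Measure ℝ)
    [∀ n, IsFiniteMeasure (ν n)] (K : ℕ → Set ℝ) (hK : ∀ n, IsCompact (K n))
    (hνK : ∀ n, ν n (K n)ᶜ = 0) (b C : ℕ → ℝ) (hb : ∀ n, 0 ≤ b n)
    (h : ∀ n, HasAverageDecay (ν n) (b n) (C n)) :
    ∃ (R : Set ℝ) (μ : Measure ℝ), IsCompact R ∧ R ⊆ Set.Icc 1 2 ∧ dimH R ≤ ENNReal.ofReal α ∧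
      IsProbabilityMeasure μ ∧ μ Rᶜ = 0 ∧
      ∀ n s, 0 ≤ s → s ≤ 1 → s < α + 2 * b n →
        ∃ D, ∀ ξ, ‖∫ x, ft1 (ν n) (ξ * x) ∂μ‖ ^ 2 * |ξ| ^ s ≤ D := by
  set q : ℝ := 2 ^ α with hq_def
  have hq : 1 ≤ q := Real.one_le_rpow (by norm_num) hα.le
  set x : ℕ → ℝ := fun m => √(m + 1) with hx_def
  have hx1 : ∀ m, 1 ≤ x m := fun m => by
    rw [hx_def, Real.one_le_sqrt]
    linarith [(Nat.cast_nonneg m : (0 : ℝ) ≤ m)]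
  have hcont : ∀ n ξ, Continuous fun z => ft1 (ν n) (ξ * z) := fun n ξ =>
    (continuous_ft1 (ν n)).comp (continuous_const.mul continuous_id)
  set J : ℕ → Finset (ℕ × ℕ) := fun k => Finset.range (k + 1) ×ˢ Finset.range (256 ^ k) with hJ
  obtain ⟨σ, hσ, hd⟩ := exists_digits J
    (fun j k => dyadicAverage (fun z => ft1 (ν j.1) (x j.2 * z)) k)
    (fun j k => C j.1 * x j.2 ^ (-b j.1) * min 1 (2 ^ k / x j.2))
    (fun j k => (continuous_dyadicAverage (hcont _ _) k).measurable)
    (fun j k y hy => (h j.1).norm_dyadicAverage_le (hb _) (by linarith [hx1 j.2]) k hy)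
    (fun j k y => dyadicAverage_eq_half_mul_add (hcont _ _) k y) hq
  set A : Set ℝ := digitLim q σ '' Set.Ico 0 1 with hA
  have hA12 : A ⊆ Set.Icc 1 2 := by
    rintro _ ⟨t, -, rfl⟩
    exact digitLim_mem_Icc_one_two hσ t
  have hR12 : closure A ⊆ Set.Icc 1 2 := closure_minimal hA12 isClosed_Icc
  have hmeas := measurable_digitLim (q := q) hσ
  set P : Measure ℝ := volume.restrict (Set.Ico 0 1) with hP
  have hPprob : IsProbabilityMeasure P := ⟨by simp [hP]⟩
  set μ : Measure ℝ := P.map (digitLim q σ) with hμ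
  have hμprob : IsProbabilityMeasure μ := Measure.isProbabilityMeasure_map hmeas.aemeasurable
  have hμR : μ (closure A)ᶜ = 0 := by
    rw [hμ, Measure.map_apply hmeas isClosed_closure.measurableSet.compl, hP,
      Measure.restrict_apply (hmeas isClosed_closure.measurableSet.compl)]
    have : digitLim q σ ⁻¹' (closure A)ᶜ ∩ Set.Ico 0 1 = ∅ := by
      ext t
      simp only [Set.mem_inter_iff, Set.mem_preimage, Set.mem_compl_iff, Set.mem_empty_iff_false,
        iff_false, not_and]
      intro h1 h2
      exact h1 (subset_closure ⟨t, h2, rfl⟩)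
    rw [this, measure_empty]
  refine ⟨closure A, μ, isCompact_Icc.of_isClosed_subset isClosed_closure hR12, hR12, ?_, hμprob,
    hμR, fun n s hs0 hs1 hs => ?_⟩
  · refine dimH_le_of_forall_cover _ hα.le fun k => ?_
    obtain ⟨F, hFcard, hF⟩ := exists_finset_digitSum_mem hq σ k
    refine ⟨F, hFcard, closure_minimal ?_ (isClosed_iUnion_of_finite fun v => isClosed_Icc)⟩
    rintro _ ⟨t, ht, rfl⟩
    exact Set.mem_iUnion.2 ⟨⟨_, hF t ht⟩, digitLim_mem_Icc hσ k t⟩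
  · obtain ⟨D, hD0, hD⟩ := exists_norm_limit_le hs1 hα (hb n) hs (h n).nonneg n
    obtain ⟨l, hl0, hl⟩ := exists_norm_ft1_sub_le (hK n) (hνK n)
    have hae : ∀ᵐ y ∂μ, y ∈ Set.Icc (1 : ℝ) 2 := by
      rw [ae_iff]
      exact measure_mono_null (Set.compl_subset_compl.2 hR12) hμR
    have hint : ∀ ξ, Integrable (fun y => ft1 (ν n) (ξ * y)) μ := fun ξ =>
      Integrable.of_bound (hcont n ξ).aestronglyMeasurable _ (ae_of_all _ fun y => norm_ft1_le _ _)
    refine exists_norm_sq_mul_rpow_le (D := D) (l := l * 2) (M := (ν n).real Set.univ) hs0 hs1 hD0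
      (by positivity) (fun m => ?_) (fun ξ η => ?_) (fun ξ => ?_) fun ξ => ?_
    · refine hD (x m) (hx1 m) (fun k => ∫ t in Set.Ico (0 : ℝ) 1,
        dyadicAverage (fun z => ft1 (ν n) (x m * z)) k (digitSum q σ k t)) _ ?_ (fun k => ?_)
        fun k hnk hmk => ?_
      · rw [hμ, integral_map hmeas.aemeasurable (hcont n _).aestronglyMeasurable]
        refine tendsto_integral_of_dominated_convergence (fun _ => (ν n).real Set.univ)
          (fun k => ?_) (integrable_const _) (fun k => ?_) (ae_of_all _ fun t => ?_)
        · exact ((continuous_dyadicAverage (hcont n _) k).measurable.comp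
            (measurable_digitSum q σ k)).aestronglyMeasurable
        · refine ae_of_all _ fun t => ?_
          rw [← sub_zero (dyadicAverage _ _ _)]
          refine norm_dyadicAverage_sub_le (hcont n _) fun z _ => ?_
          rw [sub_zero]
          exact norm_ft1_le _ _
        · exact tendsto_dyadicAverage (hcont n _) fun k => digitLim_mem_Icc hσ k t
      · refine (norm_integral_le_of_norm_le_const (ae_of_all _ fun t =>
          (h n).norm_dyadicAverage_le (hb n) (by linarith [hx1 m]) k
            (one_le_digitSum hσ k t))).trans_eq ?_
        simp
      · have hmem : (n, m) ∈ J k := by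
          simp only [hJ, Finset.mem_product, Finset.mem_range]
          refine ⟨by omega, ?_⟩
          have h1 : x m ^ 2 ≤ (16 ^ k) ^ 2 := by
            gcongr
          rw [hx_def, Real.sq_sqrt (by positivity), ← pow_mul, mul_comm, pow_mul] at h1
          norm_num at h1
          have h2 : m + 1 ≤ 256 ^ k := by exact_mod_cast h1
          omega
        refine (hd k (n, m) hmem).trans ?_
        have hcard : (J k).card = (k + 1) * 256 ^ k := by
          simp [hJ]
        have hlog := log_mul_pow_add_half_le k
        rw [hcard]
        have hC := (h n).nonneg
        have hxm : 0 < x m := by linarith [hx1 m]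
        exact mul_le_mul_of_nonneg_right (by linarith) (by positivity)
    · rw [← integral_sub (hint _) (hint _)]
      refine (norm_integral_le_of_norm_le_const (C := l * 2 * |ξ - η|) ?_).trans_eq (by simp)
      filter_upwards [hae] with y hy
      refine (hl _ _).trans ?_
      rw [← sub_mul, abs_mul, abs_of_nonneg (by linarith [hy.1] : 0 ≤ y), mul_assoc, mul_comm 2]
      gcongr
      exact hy.2
    · rw [← RCLike.norm_conj, ← integral_conj]
      congr 2
      ext y
      rw [neg_mul, ft1_neg, Complex.conj_conj]
    · refine (norm_integral_le_of_norm_le_const (ae_of_all _ fun y =>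
        norm_ft1_le _ _)).trans_eq (by simp)

theorem exists_norm_ft1_le_one_add_abs_rpow (μ : Measure ℝ) [IsFiniteMeasure μ] {s C : ℝ}
    (hs0 : 0 ≤ s) (hs1 : s ≤ 1) (hC : ∀ ξ, ‖ft1 μ ξ‖ ^ 2 * |ξ| ^ s ≤ C) :
    ∃ C', ∀ ξ, ‖ft1 μ ξ‖ ≤ C' * (1 + |ξ|) ^ (-(s / 2)) := by
  have hM := norm_ft1_le μ
  set M := μ.real Set.univ
  have hM0 : 0 ≤ M := (norm_nonneg _).trans (hM 0)
  refine ⟨2 * (M + √C), fun ξ => ?_⟩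
  have h2 : (1 : ℝ) / 2 ≤ 2 ^ (-(s / 2)) := by
    rw [one_div, ← Real.rpow_neg_one]
    exact Real.rpow_le_rpow_of_exponent_le (by norm_num) (by linarith)
  have hsq := Real.sqrt_nonneg C
  rcases le_total |ξ| 1 with h | h
  · calc ‖ft1 μ ξ‖ ≤ 2 * (M + √C) * (1 / 2) := by linarith [hM ξ]
      _ ≤ 2 * (M + √C) * (1 + |ξ|) ^ (-(s / 2)) := by
        gcongr
        exact h2.trans (Real.rpow_le_rpow_of_nonpos (by positivity) (by linarith) (by linarith))
  · have hξ : 0 < |ξ| := by linarith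
    have h3 : ‖ft1 μ ξ‖ ≤ √C * |ξ| ^ (-(s / 2)) := by
      rw [Real.rpow_neg hξ.le, ← div_eq_mul_inv, le_div_iff₀ (by positivity)]
      refine Real.le_sqrt_of_sq_le ?_
      rw [mul_pow, ← Real.rpow_mul_natCast hξ.le]
      push_cast
      rw [div_mul_cancel₀ _ two_ne_zero]
      exact hC ξ
    calc ‖ft1 μ ξ‖ ≤ √C * |ξ| ^ (-(s / 2)) := h3
      _ ≤ 2 * (M + √C) * (1 / 2) * |ξ| ^ (-(s / 2)) := by
        gcongr
        linarith
      _ ≤ 2 * (M + √C) * 2 ^ (-(s / 2)) * |ξ| ^ (-(s / 2)) := by gcongr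
      _ = 2 * (M + √C) * (2 * |ξ|) ^ (-(s / 2)) := by
        rw [Real.mul_rpow (by norm_num) hξ.le]
        ring
      _ ≤ _ := by
        refine mul_le_mul_of_nonneg_left ?_ (by positivity)
        exact Real.rpow_le_rpow_of_nonpos (by positivity) (by linarith) (by linarith)

theorem ft1_dirac (y ξ : ℝ) :
    ft1 (Measure.dirac y) ξ = Complex.exp (((-2 * Real.pi * y * ξ : ℝ) : ℂ) * Complex.I) := by
  rw [ft1, integral_dirac]

/-- A measure whose Fourier transform decays at a positive rate has no atom at the origin carrying
all its mass. -/
theorem measure_compl_singleton_zero_ne_zero (μ : Measure ℝ) [IsFiniteMeasure μ] (hμ : μ ≠ 0)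
    {s C : ℝ} (hs : 0 < s) (hC : ∀ ξ, ‖ft1 μ ξ‖ ^ 2 * |ξ| ^ s ≤ C) : μ {0}ᶜ ≠ 0 := by
  intro h0
  have hpos : 0 < μ.real Set.univ := by
    rw [measureReal_def]
    exact ENNReal.toReal_pos (by simpa using hμ) (measure_ne_top _ _)
  have hae : ∀ᵐ x ∂μ, x = 0 := by
    rw [ae_iff]
    exact h0
  have hft : ∀ ξ, ‖ft1 μ ξ‖ = μ.real Set.univ := fun ξ => by
    have : ft1 μ ξ = ∫ _, (1 : ℂ) ∂μ := by
      refine integral_congr_ae ?_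
      filter_upwards [hae] with x hx
      simp [hx]
    rw [this, integral_const]
    simp
  have ht := (tendsto_rpow_atTop hs).const_mul_atTop (pow_pos hpos 2)
  obtain ⟨ξ, hξC, hξ0⟩ := ((ht.eventually_gt_atTop C).and (Filter.eventually_ge_atTop 0)).exists
  have h1 := hC ξ
  rw [hft, abs_of_nonneg hξ0] at h1
  linarith

/-- The exponents admissible in the definition of the Fourier dimension. -/
def fourierExponents (A : Set ℝ) : Set ℝ :=
  {s : ℝ | 0 ≤ s ∧ s ≤ 1 ∧ ∃ μ : Measure ℝ,
    μ ≠ 0 ∧ IsFiniteMeasure μ ∧ (∃ K, IsCompact K ∧ K ⊆ A ∧ μ Kᶜ = 0) ∧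
    ∃ C : ℝ, ∀ ξ, ‖ft1 μ ξ‖ ^ 2 * |ξ| ^ s ≤ C}

theorem bddAbove_fourierExponents (A : Set ℝ) : BddAbove (fourierExponents A) :=
  ⟨1, fun _ hs => hs.2.1⟩

theorem fDimS1_nonneg (A : Set ℝ) : 0 ≤ fDimS1 A := Real.sSup_nonneg fun _ hs => hs.1

theorem zero_mem_fourierExponents {A : Set ℝ} {y : ℝ} (hy : y ∈ A) :
    (0 : ℝ) ∈ fourierExponents A := by
  refine ⟨le_rfl, zero_le_one, Measure.dirac y, NeZero.ne _, inferInstance,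
    ⟨{y}, isCompact_singleton, Set.singleton_subset_iff.2 hy, by simp⟩, 1, fun ξ => ?_⟩
  rw [ft1_dirac, Complex.norm_exp_ofReal_mul_I]
  simp

theorem exists_hasAverageDecay_dirac {y : ℝ} (hy : y ≠ 0) :
    ∃ ν : Measure ℝ, IsFiniteMeasure ν ∧ ν ≠ 0 ∧ ν {y}ᶜ = 0 ∧ ∃ C, HasAverageDecay ν 0 C := by
  obtain ⟨ν, h1, h2, h3, h4⟩ := exists_hasAverageDecay (Measure.dirac y) (b := 0) (C := 1)
    (by simp [hy]) le_rfl zero_le_one fun ξ => by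
      rw [ft1_dirac, Complex.norm_exp_ofReal_mul_I]
      simp
  exact ⟨ν, h1, h2, h3 (by simp), h4⟩

theorem exists_hasAverageDecay_of_mem_fourierExponents {Y : Set ℝ} (hY : ∃ y ∈ Y, y ≠ 0) {s : ℝ}
    (hs : s ∈ fourierExponents Y) :
    ∃ (ν : Measure ℝ) (K : Set ℝ) (C : ℝ), IsFiniteMeasure ν ∧ ν ≠ 0 ∧ IsCompact K ∧ K ⊆ Y ∧
      ν Kᶜ = 0 ∧ HasAverageDecay ν (s / 2) C := by
  obtain ⟨hs0, hs1, μ, hμ, _, ⟨K, hK, hKY, hμK⟩, C, hC⟩ := hs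
  rcases hs0.eq_or_lt with rfl | hs0
  · obtain ⟨y, hyY, hy⟩ := hY
    obtain ⟨ν, h1, h2, h3, C', h4⟩ := exists_hasAverageDecay_dirac hy
    exact ⟨ν, {y}, C', h1, h2, isCompact_singleton, Set.singleton_subset_iff.2 hyY, h3, by simpa⟩
  · obtain ⟨C₁, hC₁⟩ := exists_norm_ft1_le_one_add_abs_rpow μ hs0.le hs1 hC
    obtain ⟨ν, h1, h2, h3, C', h4⟩ := exists_hasAverageDecay μ
      (measure_compl_singleton_zero_ne_zero μ hμ hs0 hC) (by linarith) (by linarith) hC₁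
    exact ⟨ν, K, C', h1, h2, hK, hKY, h3 hμK, h4⟩

/-- Decay of a multiplicative convolution bounds the Fourier dimension of a product set. -/
theorem le_fDimS1_image2_mul {μ ν : Measure ℝ} [IsProbabilityMeasure μ] [IsFiniteMeasure ν]
    (hν : ν ≠ 0) {R K : Set ℝ} (hR : IsCompact R) (hK : IsCompact K) (hμR : μ Rᶜ = 0)
    (hνK : ν Kᶜ = 0) {A : Set ℝ} (hA : Set.image2 (· * ·) R K ⊆ A) {s D : ℝ} (hs0 : 0 ≤ s)
    (hs1 : s ≤ 1) (hD : ∀ ξ, ‖∫ x, ft1 ν (ξ * x) ∂μ‖ ^ 2 * |ξ| ^ s ≤ D) : s ≤ fDimS1 A := by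
  have hc : IsCompact (Set.image2 (· * ·) R K) := by
    rw [← Set.image_prod]
    exact (hR.prod hK).image continuous_mul
  refine le_csSup (bddAbove_fourierExponents A) ⟨hs0, hs1,
    (μ.prod ν).map fun p => p.1 * p.2, ?_, inferInstance, ⟨Set.image2 (· * ·) R K, hc, hA,
      ?_⟩, D, fun ξ => ?_⟩
  · rw [Ne, Measure.map_eq_zero_iff (by fun_prop), ← Measure.measure_univ_eq_zero,
      ← Set.univ_prod_univ, Measure.prod_prod, measure_univ, one_mul, Measure.measure_univ_eq_zero]
    exact hν
  · rw [Measure.map_apply (by fun_prop) hc.measurableSet.compl]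
    refine measure_mono_null (t := Rᶜ ×ˢ Set.univ ∪ Set.univ ×ˢ Kᶜ) (fun p hp => ?_) ?_
    · by_contra hcon
      simp only [Set.mem_union, Set.mem_prod, Set.mem_compl_iff, Set.mem_univ, and_true, true_and,
        not_or, not_not] at hcon
      exact hp ⟨p.1, hcon.1, p.2, hcon.2, rfl⟩
    · rw [measure_union_null_iff, Measure.prod_prod, Measure.prod_prod, hμR, hνK]
      simp
  · have h1 : ft1 ((μ.prod ν).map fun p => p.1 * p.2) ξ = ∫ x, ft1 ν (ξ * x) ∂μ := by
      rw [ft1, integral_map (by fun_prop) (Continuous.aestronglyMeasurable (by fun_prop)),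
        integral_prod]
      · refine integral_congr_ae (ae_of_all _ fun x => ?_)
        simp only [ft1]
        refine integral_congr_ae (ae_of_all _ fun y => ?_)
        simp only
        congr 3
        ring
      · exact Integrable.of_bound (Continuous.aestronglyMeasurable (by fun_prop)) 1
          (ae_of_all _ fun p => norm_exp_ofReal_mul_I_le _)
    rw [h1]
    exact hD ξ

theorem stmt19 (α : ℝ) (hα0 : 0 ≤ α) (hα1 : α ≤ 1)
    (Y : Set ℝ) (hYc : IsCompact Y) (hY : ∃ y ∈ Y, y ≠ 0) :
    ∃ R : Set ℝ, IsCompact R ∧ R ⊆ Set.Ioi 0 ∧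
      dimH R = ENNReal.ofReal α ∧ fDimS1 R = α ∧
      min 1 (fDimS1 R + fDimS1 Y) ≤ fDimS1 (Set.image2 (· * ·) R Y) := by
  rcases hα0.eq_or_lt with rfl | hα
  · have hdim : dimH ({1} : Set ℝ) = 0 := dimH_singleton 1
    have hf : fDimS1 {1} = 0 := by
      refine le_antisymm ?_ (fDimS1_nonneg _)
      have := ofReal_fDimS1_le_dimH {1}
      rw [hdim, nonpos_iff_eq_zero, ENNReal.ofReal_eq_zero] at this
      exact this
    refine ⟨{1}, isCompact_singleton, by simp, by simp [hdim], hf, ?_⟩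
    simp [hf]
  have hne : (fourierExponents Y).Nonempty := by
    obtain ⟨y, hy, -⟩ := hY
    exact ⟨0, zero_mem_fourierExponents hy⟩
  obtain ⟨u, -, hu, huY⟩ := exists_seq_tendsto_sSup hne (bddAbove_fourierExponents Y)
  choose ν K C hνfin hν0 hK hKY hνK hν using fun n =>
    exists_hasAverageDecay_of_mem_fourierExponents hY (huY n)
  obtain ⟨ν', hν'fin, hν'0, hν'1, C', hν'⟩ := exists_hasAverageDecay_dirac (one_ne_zero (α := ℝ))
  have hfin : ∀ n : ℕ, IsFiniteMeasure (Nat.casesOn n ν' ν : Measure ℝ) := fun n => by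
    cases n
    · exact hν'fin
    · exact hνfin _
  obtain ⟨R, μ, hR, hR12, hdim, hμ, hμR, hD⟩ := exists_measure_decay hα
    (fun n => Nat.casesOn n ν' ν) (fun n => Nat.casesOn n {1} K)
    (fun n => by
      cases n
      · exact isCompact_singleton
      · exact hK _)
    (fun n => by
      cases n
      · exact hν'1
      · exact hνK _)
    (fun n => Nat.casesOn n 0 fun n => u n / 2) (fun n => Nat.casesOn n C' C)
    (fun n => by
      cases n
      · exact le_rfl
      · exact div_nonneg (huY _).1 zero_le_two)
    (fun n => by
      cases n
      · exact hν'
      · exact hν _)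
  have hRα : fDimS1 R = α := by
    refine le_antisymm ?_ (le_of_forall_lt fun s hs => ?_)
    · exact (ENNReal.ofReal_le_ofReal_iff hα.le).1 ((ofReal_fDimS1_le_dimH R).trans hdim)
    · obtain ⟨s', hs1, hs2⟩ := exists_between (max_lt hs hα)
      obtain ⟨D, hD⟩ := hD 0 s' ((le_max_right _ _).trans hs1.le) (by linarith)
        (by simpa using hs2)
      refine ((le_max_left _ _).trans_lt hs1).trans_le ?_
      exact le_fDimS1_image2_mul hν'0 hR isCompact_singleton hμR hν'1 (by simp)
        ((le_max_right _ _).trans hs1.le) (by linarith) hD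
  refine ⟨R, hR, fun x hx => zero_lt_one.trans_le (hR12 hx).1, le_antisymm hdim ?_, hRα, ?_⟩
  · rw [← hRα]
    exact ofReal_fDimS1_le_dimH R
  · rw [hRα]
    refine le_of_forall_lt fun s hs => ?_
    have hY0 : 0 ≤ fDimS1 Y := fDimS1_nonneg Y
    obtain ⟨s', hs1, hs2⟩ := exists_between
      (max_lt hs (lt_min zero_lt_one (by linarith : 0 < α + fDimS1 Y)))
    have hs'1 := hs2.trans_le (min_le_left _ _)
    have hs'Y := hs2.trans_le (min_le_right _ _)
    obtain ⟨n, hn⟩ := (hu.eventually (lt_mem_nhds (show s' - α < sSup (fourierExponents Y) from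
      sub_lt_iff_lt_add'.2 hs'Y))).exists
    obtain ⟨D, hD⟩ := hD (n + 1) s' ((le_max_right _ _).trans hs1.le) hs'1.le (by
      simp only
      linarith)
    refine ((le_max_left _ _).trans_lt hs1).trans_le ?_
    exact le_fDimS1_image2_mul (hν0 n) hR (hK n) hμR (hνK n)
      (Set.image2_subset subset_rfl (hKY n)) ((le_max_right _ _).trans hs1.le) hs'1.le hD
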